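/- Let u be a real number with 0 < u < log((3+√5)/2) and ξ := u + 2π√-1. Let β(u) denote the square root of (e^u+e^{-u}+1)(e^u+e^{-u}-3) chosen to be a positive multiple of √-1, and let √(-ξβ(u)) be the square root lying in the fourth quadrant. Then the colored Jones polynomial of the figure-eight knot satisfies the asymptotic equivalence J_N(E; exp(ξ/N)) · 2 sinh(u/2) · √(-ξβ(u)) / ( √(2πN) · exp((N/ξ) S(u)) ) → 1 as N → ∞. Equivalently, J_N(E; exp(ξ/N)) ∼ (√(-π)/(2 sinh(u/2))) T(u)^{1/2} (N/ξ)^{1/2} exp((N/ξ) S(u)). -/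

import Mathlib

open Complex MeasureTheory Filter Topology Finset

noncomputable section

/-- The dilogarithm `Li₂(z) = -∫₀^z log(1-x)/x dx` along the segment from `0` to `z`. -/
def dilog (z : ℂ) : ℂ := -∫ t in (0:ℝ)..1, Complex.log (1 - (t:ℂ) * z) / (t:ℂ)

/-- Colored Jones polynomial of the figure-eight knot (Habiro–Le formula). -/
def JE (N : ℕ) (q : ℂ) : ℂ :=
  ∑ k ∈ Finset.range N, ∏ l ∈ Finset.Icc 1 k,
    ((q ^ (((N:ℂ) - (l:ℂ))/2) - q ^ (-(((N:ℂ) - (l:ℂ))/2))) *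
     (q ^ (((N:ℂ) + (l:ℂ))/2) - q ^ (-(((N:ℂ) + (l:ℂ))/2))))

/-- Integral over the contour `C_R = (-∞,-R] ∪ Ω_R ∪ [R,∞)`, where `Ω_R` is the upper
semicircle of radius `R` traversed from `-R` to `R`. -/
def contourCR (R : ℝ) (f : ℂ → ℂ) : ℂ :=
  (∫ t in Set.Iic (-R), f (t:ℂ)) +
  (∫ s in (0:ℝ)..Real.pi,
      f ((R:ℂ) * Complex.exp (Complex.I * ((Real.pi:ℂ) - (s:ℂ)))) *
        (-Complex.I * (R:ℂ) * Complex.exp (Complex.I * ((Real.pi:ℂ) - (s:ℂ))))) +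
  (∫ t in Set.Ici R, f (t:ℂ))

/-- Faddeev's quantum dilogarithm `S_γ(z)`. -/
def Sqd (γ : ℂ) (R : ℝ) (z : ℂ) : ℂ :=
  Complex.exp ((1/4) * contourCR R
    (fun t => Complex.exp (z * t) / (Complex.sinh ((Real.pi:ℂ) * t) * Complex.sinh (γ * t) * t)))

/-- The square root of `(e^u+e^{-u}+1)(e^u+e^{-u}-3)` chosen as a positive multiple of `√-1`. -/
def betaRoot (u : ℝ) : ℂ :=
  Complex.I * (Real.sqrt (-((Real.exp u + Real.exp (-u) + 1) * (Real.exp u + Real.exp (-u) - 3))) : ℝ)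

/-- `φ(u) = arccosh(cosh u - 1/2)` with the branch described in the paper. -/
def phiu (u : ℝ) : ℂ :=
  Complex.log (((Real.exp u + Real.exp (-u) - 1 : ℝ) - betaRoot u) / 2)

/-- `S(u) = Li₂(e^{u-φ(u)}) - Li₂(e^{u+φ(u)}) - uφ(u)`. -/
def Su (u : ℝ) : ℂ :=
  dilog (Complex.exp ((u:ℂ) - phiu u)) - dilog (Complex.exp ((u:ℂ) + phiu u)) - (u:ℂ) * phiu u

/-- `Φ(w) = (1/ξ)(Li₂(e^{u-ξw}) - Li₂(e^{u+ξw})) - uw` with `ξ = u + 2π√-1`. -/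
def Phi (u : ℝ) (w : ℂ) : ℂ :=
  (1/((u:ℂ) + 2*(Real.pi:ℂ)*Complex.I)) *
    (dilog (Complex.exp ((u:ℂ) - ((u:ℂ) + 2*(Real.pi:ℂ)*Complex.I) * w)) -
     dilog (Complex.exp ((u:ℂ) + ((u:ℂ) + 2*(Real.pi:ℂ)*Complex.I) * w))) - (u:ℂ) * w

/-- `g_N(w) = e^{-Nuw} S_γ(π-√-1u+√-1ξw)/S_γ(-π-√-1u-√-1ξw)`, `γ = (2π-√-1u)/(2N)`. -/
def gN (u : ℝ) (N : ℕ) (R : ℝ) (w : ℂ) : ℂ :=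
  Complex.exp (-(N:ℂ) * (u:ℂ) * w) *
    Sqd ((2*(Real.pi:ℂ) - Complex.I*(u:ℂ))/(2*(N:ℂ))) R
      ((Real.pi:ℂ) - Complex.I*(u:ℂ) + Complex.I*((u:ℂ) + 2*(Real.pi:ℂ)*Complex.I)*w) /
    Sqd ((2*(Real.pi:ℂ) - Complex.I*(u:ℂ))/(2*(N:ℂ))) R
      (-(Real.pi:ℂ) - Complex.I*(u:ℂ) - Complex.I*((u:ℂ) + 2*(Real.pi:ℂ)*Complex.I)*w)

/-- Integral of `f` along the straight segment from `a` to `b`. -/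
def segInt (f : ℂ → ℂ) (a b : ℂ) : ℂ :=
  ∫ t in (0:ℝ)..1, f (a + (t:ℂ) * (b - a)) * (b - a)

/-- Integral of `f` along the polygonal line through the given list of vertices. -/
def polyInt (f : ℂ → ℂ) : List ℂ → ℂ
  | a :: b :: rest => segInt f a b + polyInt f (b :: rest)
  | _ => 0

/-- Vertices of the polygonal line `C_+(ε)`. -/
def Cplus (u ε : ℝ) : List ℂ :=
  [((1 - ε : ℝ) : ℂ),
   ((1 - u/(2*Real.pi) - ε : ℝ) : ℂ) + Complex.I,
   ((-(u/(2*Real.pi)) + ε : ℝ) : ℂ) + Complex.I,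
   ((ε : ℝ) : ℂ)]

/-- Vertices of the polygonal line `C_-(ε)`. -/
def Cminus (u ε : ℝ) : List ℂ :=
  [((ε : ℝ) : ℂ),
   ((u/(2*Real.pi) : ℝ) : ℂ) - Complex.I,
   ((1 + u/(2*Real.pi) : ℝ) : ℂ) - Complex.I,
   ((1 - ε : ℝ) : ℂ)]

/-- `I_γ(z)` from Andersen–Hansen. -/
def Iqd (γ : ℂ) (R : ℝ) (z : ℂ) : ℂ :=
  (1/4) * contourCR R
    (fun t => Complex.exp (z * t) / (t * Complex.sinh ((Real.pi:ℂ) * t)) *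
      (1/Complex.sinh (γ * t) - 1/(γ * t)))

end

/-- The series `∑ e^{nv}/n²`, that is `Li₂(e^v)`, for `Re v ≤ 0`. -/
noncomputable def li (v : ℂ) : ℂ := ∑' n : ℕ, exp (((n:ℂ) + 1) * v) / ((n:ℂ) + 1) ^ 2

lemma norm_natCast_add_one (n : ℕ) : ‖(n:ℂ) + 1‖ = (n:ℝ) + 1 := by
  have := Complex.norm_natCast (n + 1)
  push_cast at this
  exact this

lemma norm_exp_succ_mul (n : ℕ) (v : ℂ) :
    ‖exp (((n:ℂ) + 1) * v)‖ = Real.exp (((n:ℝ) + 1) * v.re) := by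
  rw [Complex.norm_exp]
  congr 1
  simp

lemma norm_exp_succ_mul_le (n : ℕ) {v : ℂ} (hv : v.re ≤ 0) :
    ‖exp (((n:ℂ) + 1) * v)‖ ≤ 1 := by
  rw [norm_exp_succ_mul, Real.exp_le_one_iff]
  exact mul_nonpos_of_nonneg_of_nonpos (by positivity) hv

lemma hasSum_one_div_succ_sq : HasSum (fun n : ℕ => 1 / ((n:ℝ) + 1) ^ 2) (Real.pi ^ 2 / 6) := by
  have := (hasSum_nat_add_iff' 1).mpr hasSum_zeta_two
  simpa using this

lemma norm_li_term_le (n : ℕ) {v : ℂ} (hv : v.re ≤ 0) :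
    ‖exp (((n:ℂ) + 1) * v) / ((n:ℂ) + 1) ^ 2‖ ≤ 1 / ((n:ℝ) + 1) ^ 2 := by
  rw [norm_div, norm_pow, norm_natCast_add_one]
  gcongr
  exact norm_exp_succ_mul_le n hv

lemma summable_li {v : ℂ} (hv : v.re ≤ 0) :
    Summable (fun n : ℕ => exp (((n:ℂ) + 1) * v) / ((n:ℂ) + 1) ^ 2) :=
  Summable.of_norm_bounded hasSum_one_div_succ_sq.summable (fun n => norm_li_term_le n hv)

lemma norm_li_le {v : ℂ} (hv : v.re ≤ 0) : ‖li v‖ ≤ Real.pi ^ 2 / 6 :=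
  tsum_of_norm_bounded hasSum_one_div_succ_sq (fun n => norm_li_term_le n hv)

lemma norm_exp_sub_exp_le {a b : ℂ} (ha : a.re ≤ 0) (hb : b.re ≤ 0) :
    ‖exp a - exp b‖ ≤ ‖a - b‖ := by
  have := Convex.norm_image_sub_le_of_norm_hasDerivWithin_le (f := exp) (f' := exp) (C := 1)
    (s := {z : ℂ | z.re ≤ 0}) (x := b) (y := a)
    (fun x _ => (Complex.hasDerivAt_exp x).hasDerivWithinAt)
    (fun x hx => by rw [Complex.norm_exp]; exact Real.exp_le_one_iff.mpr hx)
    (convex_halfSpace_re_le 0) hb ha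
  simpa using this

lemma exists_norm_li_sub_le : ∃ K : ℝ, 0 ≤ K ∧ ∀ a b : ℂ, a.re ≤ 0 → b.re ≤ 0 →
    ‖li a - li b‖ ≤ K * √‖a - b‖ := by
  have hs : Summable (fun n : ℕ => 2 / ((n:ℝ) + 1) ^ (3/2 : ℝ)) := by
    have := (summable_nat_add_iff 1).mpr
      (Real.summable_one_div_nat_rpow (p := 3/2) |>.mpr (by norm_num))
    refine (this.mul_left 2).congr fun n => ?_
    push_cast
    ring
  refine ⟨∑' n : ℕ, 2 / ((n:ℝ) + 1) ^ (3/2 : ℝ), tsum_nonneg fun n => by positivity, ?_⟩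
  intro a b ha hb
  rw [li, li, ← (summable_li ha).tsum_sub (summable_li hb)]
  refine tsum_of_norm_bounded (hs.hasSum.mul_right _) fun n => ?_
  rw [← sub_div, norm_div, norm_pow, norm_natCast_add_one]
  have hn : (0:ℝ) < (n:ℝ) + 1 := by positivity
  have h1 : ‖exp (((n:ℂ) + 1) * a) - exp (((n:ℂ) + 1) * b)‖ ≤ ((n:ℝ) + 1) * ‖a - b‖ := by
    have := norm_exp_sub_exp_le (a := ((n:ℂ) + 1) * a) (b := ((n:ℂ) + 1) * b)
      (by simpa using mul_nonpos_of_nonneg_of_nonpos hn.le ha)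
      (by simpa using mul_nonpos_of_nonneg_of_nonpos hn.le hb)
    rwa [← mul_sub, norm_mul, norm_natCast_add_one] at this
  have h2 : ‖exp (((n:ℂ) + 1) * a) - exp (((n:ℂ) + 1) * b)‖ ≤ 2 := by
    refine (norm_sub_le _ _).trans ?_
    linarith [norm_exp_succ_mul_le n ha, norm_exp_succ_mul_le n hb]
  have h3 : ‖exp (((n:ℂ) + 1) * a) - exp (((n:ℂ) + 1) * b)‖ ≤ 2 * (√((n:ℝ) + 1) * √‖a - b‖) := by
    rw [← Real.sqrt_mul hn.le]
    set x := ((n:ℝ) + 1) * ‖a - b‖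
    have hx : 0 ≤ x := by positivity
    have := Real.sq_sqrt hx
    have h0 := Real.sqrt_nonneg x
    rcases le_total (√x) 1 with h | h
    · nlinarith
    · nlinarith
  have h4 : ((n:ℝ) + 1) ^ 2 = ((n:ℝ) + 1) ^ (3/2 : ℝ) * √((n:ℝ) + 1) := by
    rw [Real.sqrt_eq_rpow, ← Real.rpow_add hn]
    norm_num
  rw [h4, div_mul_eq_mul_div, div_le_div_iff₀ (by positivity) (by positivity)]
  calc _ ≤ 2 * (√((n:ℝ) + 1) * √‖a - b‖) * ((n:ℝ) + 1) ^ (3/2 : ℝ) := by gcongr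
    _ = _ := by ring

lemma hasSum_exp_div_succ {v : ℂ} (hv : v.re < 0) :
    HasSum (fun n : ℕ => exp (((n:ℂ) + 1) * v) / ((n:ℂ) + 1)) (-log (1 - exp v)) := by
  have h1 : ‖exp v‖ < 1 := by rw [Complex.norm_exp]; exact Real.exp_lt_one_iff.mpr hv
  have := (hasSum_nat_add_iff' 1).mpr (Complex.hasSum_taylorSeries_neg_log h1)
  simp only [range_one, sum_singleton, pow_zero, Nat.cast_zero, div_zero, sub_zero] at this
  refine this.congr_fun ?_
  intro n
  rw [← Complex.exp_nat_mul]
  push_cast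
  rfl

lemma hasDerivAt_li {v : ℂ} (hv : v.re < 0) : HasDerivAt li (-log (1 - exp v)) v := by
  obtain ⟨δ, hδ, hvδ⟩ : ∃ δ : ℝ, 0 < δ ∧ v.re < -δ := ⟨-v.re / 2, by linarith, by linarith⟩
  set S : Set ℂ := {z : ℂ | z.re < -δ}
  have hb : ∀ (n : ℕ) (y : ℂ), y ∈ S → ‖exp (((n:ℂ) + 1) * y) / ((n:ℂ) + 1)‖
      ≤ Real.exp (-δ) ^ (n + 1) := by
    intro n y hy
    rw [norm_div, norm_natCast_add_one, norm_exp_succ_mul, ← Real.exp_nat_mul]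
    refine (div_le_self (by positivity) (by linarith [n.cast_nonneg (α := ℝ)])).trans ?_
    rw [Real.exp_le_exp]
    push_cast
    exact mul_le_mul_of_nonneg_left (le_of_lt hy) (by positivity)
  have hs : Summable (fun n : ℕ => Real.exp (-δ) ^ (n + 1)) :=
    (summable_nat_add_iff 1).mpr (summable_geometric_of_lt_one (by positivity)
      (by rw [Real.exp_lt_one_iff]; linarith))
  have hd := hasDerivAt_tsum_of_isPreconnected hs
    (g := fun (n : ℕ) (v : ℂ) => exp (((n:ℂ) + 1) * v) / ((n:ℂ) + 1) ^ 2)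
    (g' := fun (n : ℕ) (v : ℂ) => exp (((n:ℂ) + 1) * v) / ((n:ℂ) + 1)) (t := S) (y₀ := v) (y := v)
    (isOpen_lt continuous_re continuous_const) (convex_halfSpace_re_lt _).isPreconnected
    (fun n y _ => by
      have hne : (n:ℂ) + 1 ≠ 0 := Nat.cast_add_one_ne_zero n
      have h := (((hasDerivAt_id y).const_mul ((n:ℂ) + 1)).cexp).div_const (((n:ℂ) + 1) ^ 2)
      exact h.congr_deriv (by simp only [id]; field_simp)) hb hvδ (summable_li hv.le) hvδ
  rw [(hasSum_exp_div_succ hv).tsum_eq] at hd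
  exact hd

lemma li_conj (v : ℂ) : li (starRingEnd ℂ v) = starRingEnd ℂ (li v) := by
  rw [li, li, Complex.conj_tsum]
  congr 1
  ext n
  simp [← Complex.exp_conj]

lemma li_I_add_li_neg_I {α : ℝ} (h0 : 0 ≤ α) (h1 : α ≤ 2 * Real.pi) :
    li (α * I) + li (-(α * I)) = ((Real.pi ^ 2 / 3 - Real.pi * α + α ^ 2 / 2 : ℝ) : ℂ) := by
  have hx : α / (2 * Real.pi) ∈ Set.Icc (0:ℝ) 1 :=
    ⟨by positivity, by rw [div_le_one (by positivity)]; exact h1⟩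
  have h := hasSum_one_div_nat_pow_mul_cos (k := 1) one_ne_zero hx
  have h := (hasSum_nat_add_iff' 1).mpr h
  rw [li, li, ← (summable_li (by simp)).tsum_add (summable_li (by simp))]
  have h2 : ∀ n : ℕ, exp (((n:ℂ) + 1) * (α * I)) / ((n:ℂ) + 1) ^ 2 +
      exp (((n:ℂ) + 1) * (-(α * I))) / ((n:ℂ) + 1) ^ 2 =
      ((2 * (1 / ((n + 1 : ℕ):ℝ) ^ (2 * 1) *
        Real.cos (2 * Real.pi * ((n + 1 : ℕ):ℝ) * (α / (2 * Real.pi))))  : ℝ) : ℂ) := by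
    intro n
    have e : 2 * Real.pi * ((n + 1 : ℕ):ℝ) * (α / (2 * Real.pi)) = ((n:ℝ) + 1) * α := by
      push_cast; field_simp
    rw [e]
    push_cast
    rw [Complex.cos]
    ring_nf
  simp_rw [h2]
  rw [← Complex.ofReal_tsum, (h.mul_left 2).tsum_eq]
  congr 1
  have hB : (Polynomial.map (algebraMap ℚ ℝ) (Polynomial.bernoulli (2 * 1))).eval
      (α / (2 * Real.pi)) = (α / (2 * Real.pi)) ^ 2 - α / (2 * Real.pi) + 1 / 6 := by
    have := bernoulliFun_two (α / (2 * Real.pi))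
    rw [bernoulliFun] at this
    simpa using this
  rw [hB]
  simp
  field_simp
  ring

/-- `ξ = u + 2πi`. -/
noncomputable def xi (u : ℝ) : ℂ := (u:ℂ) + 2 * (Real.pi:ℂ) * I

/-- `ξ / N`. -/
noncomputable def step (u : ℝ) (N : ℕ) : ℂ := xi u / N

@[simp] lemma xi_re (u : ℝ) : (xi u).re = u := by simp [xi]
@[simp] lemma xi_im (u : ℝ) : (xi u).im = 2 * Real.pi := by simp [xi]

lemma xi_ne_zero (u : ℝ) : xi u ≠ 0 := fun h => by
  have := congrArg Complex.im h
  simp [Real.pi_ne_zero] at this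

@[simp] lemma step_re (u : ℝ) (N : ℕ) : (step u N).re = u / N := by
  rw [step, ← ofReal_natCast, div_ofReal_re, xi_re]

@[simp] lemma step_im (u : ℝ) (N : ℕ) : (step u N).im = 2 * Real.pi / N := by
  rw [step, ← ofReal_natCast, div_ofReal_im, xi_im]

lemma natCast_mul_step (u : ℝ) {N : ℕ} (hN : N ≠ 0) : (N:ℂ) * step u N = xi u := by
  rw [step, mul_div_cancel₀]
  exact_mod_cast hN

/-- The logarithm of the inverse of the quantum dilogarithm `∏ (1 - e^{v - (j+1/2)ξ/N})`. -/
noncomputable def ell (u : ℝ) (N : ℕ) (v : ℂ) : ℂ :=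
  ∑' n : ℕ, exp (((n:ℂ) + 1) * v) / (((n:ℂ) + 1) * (2 * sinh (((n:ℂ) + 1) * step u N / 2)))

lemma two_mul_sinh_le_norm (z : ℂ) : 2 * Real.sinh z.re ≤ ‖2 * sinh z‖ := by
  rw [Complex.two_sinh, Real.sinh_eq, mul_div_cancel₀ _ (two_ne_zero' ℝ)]
  refine le_trans ?_ (norm_sub_norm_le _ _)
  rw [Complex.norm_exp, Complex.norm_exp]
  simp

lemma re_le_norm_two_mul_sinh {z : ℂ} (hz : 0 ≤ z.re) : z.re ≤ ‖2 * sinh (z / 2)‖ := by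
  refine le_trans ?_ (two_mul_sinh_le_norm _)
  have : (z / 2).re = z.re / 2 := by
    rw [show (2:ℂ) = ((2:ℝ):ℂ) by norm_num, div_ofReal_re]
  rw [this]
  have := Real.self_le_sinh_iff.mpr (show 0 ≤ z.re / 2 by linarith)
  linarith

lemma norm_two_sinh_sub_le (z : ℂ) : ‖2 * sinh z - 2 * z‖ ≤ 2 * (‖z‖ ^ 3 * Real.exp ‖z‖) := by
  have h1 := Complex.norm_exp_sub_sum_le_norm_mul_exp z 3
  have h2 := Complex.norm_exp_sub_sum_le_norm_mul_exp (-z) 3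
  rw [norm_neg] at h2
  have : 2 * sinh z - 2 * z = (exp z - ∑ m ∈ range 3, z ^ m / (m.factorial:ℂ)) -
      (exp (-z) - ∑ m ∈ range 3, (-z) ^ m / (m.factorial:ℂ)) := by
    rw [Complex.two_sinh]
    simp [sum_range_succ]
    ring
  rw [this]
  refine (norm_sub_le _ _).trans ?_
  linarith

lemma exists_norm_inv_sinh_sub_le {u : ℝ} (hu : 0 < u) : ∃ C : ℝ, 0 < C ∧ ∀ r : ℝ, 0 < r →
    ‖1 / (2 * sinh (r * xi u / 2)) - 1 / (r * xi u)‖ ≤ C * (r / (1 + r ^ 2)) := by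
  set X := ‖xi u‖
  have hX : 0 < X := norm_pos_iff.mpr (xi_ne_zero u)
  refine ⟨max (2 * (X ^ 2 * Real.exp X / u)) (4 / u), by positivity, fun r hr => ?_⟩
  have hre : (r * xi u).re = r * u := by simp
  have hs : r * u ≤ ‖2 * sinh (r * xi u / 2)‖ := by
    rw [← hre]
    exact re_le_norm_two_mul_sinh (by rw [hre]; positivity)
  have hru : 0 < r * u := by positivity
  have hs0 : (2 * sinh (r * xi u / 2)) ≠ 0 := norm_pos_iff.mp (hru.trans_le hs)
  have hx0 : (r * xi u : ℂ) ≠ 0 := mul_ne_zero (by exact_mod_cast hr.ne') (xi_ne_zero u)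
  have hnx : ‖(r * xi u : ℂ)‖ = r * X := by
    rw [norm_mul, Complex.norm_real, Real.norm_of_nonneg hr.le]
  rcases le_total r 1 with h | h
  · have h1 : ‖1 / (2 * sinh (r * xi u / 2)) - 1 / (r * xi u)‖ ≤ X ^ 2 * Real.exp X / u * r := by
      rw [div_sub_div _ _ hs0 hx0, norm_div, norm_mul, hnx, one_mul, mul_one, norm_sub_rev,
        div_le_iff₀ (by positivity)]
      have := norm_two_sinh_sub_le (r * xi u / 2)
      rw [mul_div_cancel₀ _ (two_ne_zero' ℂ), norm_div, hnx] at this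
      simp only [Complex.norm_ofNat] at this
      calc _ ≤ 2 * ((r * X / 2) ^ 3 * Real.exp (r * X / 2)) := this
        _ ≤ 2 * ((r * X) ^ 3 / 2 * Real.exp X) := by
          gcongr
          · have : 0 < (r * X) ^ 3 := by positivity
            rw [div_pow]; linarith
          · nlinarith
        _ = X ^ 2 * Real.exp X / u * r * (r * u * (r * X)) := by field_simp
        _ ≤ _ := by gcongr
    calc _ ≤ _ := h1
      _ = 2 * (X ^ 2 * Real.exp X / u) * (r / 2) := by ring
      _ ≤ _ := by
        gcongr
        · exact le_max_left _ _
        · nlinarith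
  · have h1 : ‖1 / (2 * sinh (r * xi u / 2)) - 1 / (r * xi u)‖ ≤ 2 / (r * u) := by
      refine (norm_sub_le _ _).trans ?_
      rw [norm_div, norm_div, hnx, norm_one]
      have e1 : 1 / ‖2 * sinh (r * xi u / 2)‖ ≤ 1 / (r * u) := by gcongr
      have e2 : 1 / (r * X) ≤ 1 / (r * u) := by
        gcongr
        have := Complex.re_le_norm (xi u)
        rwa [xi_re] at this
      calc _ ≤ 1 / (r * u) + 1 / (r * u) := add_le_add e1 e2
        _ = _ := by ring
    calc _ ≤ _ := h1
      _ = 4 / u * (1 / (2 * r)) := by field_simp; norm_num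
      _ ≤ _ := by
        gcongr ?_ * ?_
        · exact le_max_right _ _
        · rw [div_le_div_iff₀ (by positivity) (by positivity)]
          nlinarith

lemma norm_ell_term_le {u : ℝ} (hu : 0 < u) {N : ℕ} (hN : N ≠ 0) (n : ℕ) {v : ℂ} {δ : ℝ}
    (hv : v.re ≤ δ) :
    ‖exp (((n:ℂ) + 1) * v) / (((n:ℂ) + 1) * (2 * sinh (((n:ℂ) + 1) * step u N / 2)))‖ ≤
      Real.exp (δ - u / (2 * N)) ^ (n + 1) / (1 - Real.exp (-(u / N))) := by
  have hN' : (0:ℝ) < N := by positivity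
  have hc : 0 < 1 - Real.exp (-(u / N)) := by
    rw [sub_pos, Real.exp_lt_one_iff, neg_lt_zero]; positivity
  have hsre : (((n:ℂ) + 1) * step u N / 2).re = ((n:ℝ) + 1) * (u / (2 * N)) := by
    rw [show (2:ℂ) = ((2:ℝ):ℂ) by norm_num, div_ofReal_re,
      show (n:ℂ) + 1 = (((n:ℝ) + 1 : ℝ) : ℂ) by push_cast; rfl, re_ofReal_mul, step_re]
    field_simp
  set a := ((n:ℝ) + 1) * (u / (2 * N))
  have h2 : Real.exp a * (1 - Real.exp (-(u / N))) ≤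
      ‖2 * sinh (((n:ℂ) + 1) * step u N / 2)‖ := by
    refine le_trans ?_ (two_mul_sinh_le_norm _)
    rw [hsre, Real.sinh_eq, mul_div_cancel₀ _ (two_ne_zero' ℝ), mul_sub, mul_one, ← Real.exp_add]
    gcongr
    have : u / N ≤ 2 * a := by
      simp only [a]
      have : 0 ≤ n * (u / N) := by positivity
      calc u / N ≤ n * (u / N) + u / N := by linarith
        _ = _ := by field_simp
    linarith
  rw [norm_div, norm_mul, norm_natCast_add_one, norm_exp_succ_mul, ← Real.exp_nat_mul]
  have hpos : 0 < ‖2 * sinh (((n:ℂ) + 1) * step u N / 2)‖ :=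
    (mul_pos (Real.exp_pos a) hc).trans_le h2
  rw [div_le_div_iff₀ (by positivity) hc]
  have e : Real.exp (((n:ℝ) + 1) * v.re) ≤ Real.exp (((n + 1 : ℕ):ℝ) * (δ - u / (2 * N))) *
      Real.exp a := by
    rw [← Real.exp_add]
    gcongr
    push_cast
    have : ((n:ℝ) + 1) * v.re ≤ ((n:ℝ) + 1) * δ := by gcongr
    simp only [a]; linarith
  calc _ ≤ Real.exp (((n + 1 : ℕ):ℝ) * (δ - u / (2 * N))) * Real.exp a *
        (1 - Real.exp (-(u / N))) := by gcongr
    _ = Real.exp (((n + 1 : ℕ):ℝ) * (δ - u / (2 * N))) *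
        (1 * (Real.exp a * (1 - Real.exp (-(u / N))))) := by ring
    _ ≤ _ := by
      gcongr
      linarith [n.cast_nonneg (α := ℝ)]

lemma summable_ell_bound (u : ℝ) (N : ℕ) {δ : ℝ} (hδ : δ < u / (2 * N)) :
    Summable (fun n : ℕ => Real.exp (δ - u / (2 * N)) ^ (n + 1) / (1 - Real.exp (-(u / N)))) :=
  ((summable_nat_add_iff 1).mpr (summable_geometric_of_lt_one (by positivity)
    (by rw [Real.exp_lt_one_iff]; linarith))).div_const _

lemma summable_ell {u : ℝ} (hu : 0 < u) {N : ℕ} (hN : N ≠ 0) {v : ℂ} (hv : v.re < u / (2 * N)) :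
    Summable (fun n : ℕ => exp (((n:ℂ) + 1) * v) /
      (((n:ℂ) + 1) * (2 * sinh (((n:ℂ) + 1) * step u N / 2)))) :=
  Summable.of_norm_bounded (summable_ell_bound u N hv) fun n => norm_ell_term_le hu hN n le_rfl

lemma differentiableAt_ell {u : ℝ} (hu : 0 < u) {N : ℕ} (hN : N ≠ 0) {v : ℂ}
    (hv : v.re < u / (2 * N)) : DifferentiableAt ℂ (ell u N) v := by
  obtain ⟨δ, h1, h2⟩ := exists_between hv
  have hU : IsOpen {z : ℂ | z.re < δ} := isOpen_lt continuous_re continuous_const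
  have := Complex.differentiableOn_tsum_of_summable_norm (summable_ell_bound u N h2)
    (F := fun (n : ℕ) (v : ℂ) => exp (((n:ℂ) + 1) * v) /
      (((n:ℂ) + 1) * (2 * sinh (((n:ℂ) + 1) * step u N / 2)))) (U := {z : ℂ | z.re < δ})
    (fun n => by fun_prop) hU (fun n w hw => norm_ell_term_le hu hN n (le_of_lt hw))
  exact (this v h1).differentiableAt (hU.mem_nhds h1)

lemma two_sinh_step_ne_zero {u : ℝ} (hu : 0 < u) {N : ℕ} (hN : N ≠ 0) (n : ℕ) :
    2 * sinh (((n:ℂ) + 1) * step u N / 2) ≠ 0 := by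
  have hN' : (0:ℝ) < N := by positivity
  have hre : (((n:ℂ) + 1) * step u N).re = ((n:ℝ) + 1) * (u / N) := by
    rw [show (n:ℂ) + 1 = (((n:ℝ) + 1 : ℝ) : ℂ) by push_cast; rfl, re_ofReal_mul, step_re]
  have h : 0 < ((n:ℝ) + 1) * (u / N) := by positivity
  have := re_le_norm_two_mul_sinh (hre ▸ h.le)
  rw [hre] at this
  exact norm_pos_iff.mp (h.trans_le this)

lemma exp_neg_ell_add {u : ℝ} (hu : 0 < u) {N : ℕ} (hN : N ≠ 0) {v : ℂ} (hv : v.re < 0) :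
    exp (-ell u N (v + step u N / 2)) = (1 - exp v) * exp (-ell u N (v - step u N / 2)) := by
  have hre : (step u N / 2).re = u / (2 * N) := by
    rw [show (2:ℂ) = ((2:ℝ):ℂ) by norm_num, div_ofReal_re, step_re]
    field_simp
  have hp : 0 < u / (2 * N) := by positivity
  have h1 : ell u N (v + step u N / 2) - ell u N (v - step u N / 2) = -log (1 - exp v) := by
    rw [ell, ell, ← (summable_ell hu hN (by rw [add_re, hre]; linarith)).tsum_sub
      (summable_ell hu hN (by rw [sub_re, hre]; linarith)), ← (hasSum_exp_div_succ hv).tsum_eq]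
    congr 1
    ext n
    have hn : (n:ℂ) + 1 ≠ 0 := Nat.cast_add_one_ne_zero n
    have hs := two_sinh_step_ne_zero hu hN n
    rw [← sub_div, div_eq_div_iff (mul_ne_zero hn hs) hn]
    rw [Complex.two_sinh,
      show ((n:ℂ) + 1) * (v + step u N / 2) = ((n:ℂ) + 1) * v + ((n:ℂ) + 1) * step u N / 2 by ring,
      show ((n:ℂ) + 1) * (v - step u N / 2) = ((n:ℂ) + 1) * v + -(((n:ℂ) + 1) * step u N / 2) by
        ring, Complex.exp_add, Complex.exp_add]
    ring
  have hne : 1 - exp v ≠ 0 := by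
    intro h
    have := congrArg norm (sub_eq_zero.mp h)
    rw [Complex.norm_exp, norm_one] at this
    exact (Real.exp_lt_one_iff.mpr hv).ne this.symm
  rw [show -ell u N (v + step u N / 2) = log (1 - exp v) + -ell u N (v - step u N / 2) by
    linear_combination -h1, Complex.exp_add, Complex.exp_log hne]

lemma ell_sub_li {u : ℝ} (hu : 0 < u) {N : ℕ} (hN : N ≠ 0) {v : ℂ} (hv : v.re ≤ 0) :
    ell u N v - N / xi u * li v = ∑' n : ℕ, exp (((n:ℂ) + 1) * v) / ((n:ℂ) + 1) *
      (1 / (2 * sinh ((((n:ℝ) + 1) / N : ℝ) * xi u / 2)) -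
        1 / ((((n:ℝ) + 1) / N : ℝ) * xi u)) := by
  have hp : 0 < u / (2 * N) := by positivity
  rw [ell, li, ← tsum_mul_left, ← (summable_ell hu hN (by linarith)).tsum_sub
    ((summable_li hv).mul_left _)]
  congr 1
  ext n
  have hn : (n:ℂ) + 1 ≠ 0 := Nat.cast_add_one_ne_zero n
  have hN' : (N:ℂ) ≠ 0 := by exact_mod_cast hN
  have hx := xi_ne_zero u
  have e : ((n:ℂ) + 1) * step u N / 2 = ((((n:ℝ) + 1) / N : ℝ) * xi u / 2) := by
    rw [step]; push_cast; ring
  have hs := two_sinh_step_ne_zero hu hN n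
  rw [e] at hs ⊢
  push_cast at hs ⊢
  field_simp

lemma sum_range_div_sq_le {N : ℕ} (hN : N ≠ 0) (m : ℕ) :
    ∑ n ∈ range m, (N:ℝ) / (N ^ 2 + ((n:ℝ) + 1) ^ 2) ≤ 2 := by
  have hN' : (0:ℝ) < N := by positivity
  calc _ ≤ ∑ n ∈ range m, 2 * (N:ℝ) * (1 / (N + (n:ℝ)) - 1 / (N + ((n + 1 : ℕ):ℝ))) := by
        refine sum_le_sum fun n _ => ?_
        push_cast
        rw [div_sub_div _ _ (by positivity) (by positivity), mul_div_assoc',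
          div_le_div_iff₀ (by positivity) (by positivity)]
        have h0 : (0:ℝ) ≤ n := n.cast_nonneg
        have : 0 ≤ (N:ℝ) * (((N:ℝ) - n - 1) ^ 2 + (N + n + 1)) := by positivity
        nlinarith
    _ = 2 * (N:ℝ) * (1 / (N + ((0:ℕ):ℝ)) - 1 / (N + (m:ℝ))) := by
        rw [← mul_sum, sum_range_sub' (fun n : ℕ => 1 / ((N:ℝ) + (n:ℝ)))]
    _ ≤ 2 * (N:ℝ) * (1 / (N + ((0:ℕ):ℝ))) := by
        gcongr
        have : 0 ≤ 1 / ((N:ℝ) + m) := by positivity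
        linarith
    _ = 2 := by simp; field_simp

lemma exists_norm_ell_sub_li_le {u : ℝ} (hu : 0 < u) : ∃ C : ℝ, 0 < C ∧ ∀ N : ℕ, N ≠ 0 →
    ∀ v : ℂ, v.re ≤ 0 → ‖ell u N v - N / xi u * li v‖ ≤ C := by
  obtain ⟨C, hC, h⟩ := exists_norm_inv_sinh_sub_le hu
  refine ⟨C * 2, by positivity, fun N hN v hv => ?_⟩
  have hN' : (0:ℝ) < N := by positivity
  have hs : Summable (fun n : ℕ => (N:ℝ) / (N ^ 2 + ((n:ℝ) + 1) ^ 2)) :=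
    summable_of_sum_range_le (fun n => by positivity) (sum_range_div_sq_le hN)
  have hle : ∑' n : ℕ, (N:ℝ) / (N ^ 2 + ((n:ℝ) + 1) ^ 2) ≤ 2 :=
    Real.tsum_le_of_sum_range_le (fun n => by positivity) (sum_range_div_sq_le hN)
  rw [ell_sub_li hu hN hv]
  refine (tsum_of_norm_bounded (hs.hasSum.mul_left C) fun n => ?_).trans (by gcongr)
  have h1 := h (((n:ℝ) + 1) / N) (by positivity)
  rw [norm_mul, norm_div, norm_natCast_add_one]
  have h2 := norm_exp_succ_mul_le n hv
  calc _ ≤ 1 / ((n:ℝ) + 1) * (C * ((((n:ℝ) + 1) / N) / (1 + (((n:ℝ) + 1) / N) ^ 2))) := by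
        gcongr
    _ = _ := by field_simp

lemma exists_norm_ell_sub_li_le_div {u : ℝ} (hu : 0 < u) : ∃ C : ℝ, 0 < C ∧ ∀ N : ℕ, N ≠ 0 →
    ∀ v : ℂ, v.re ≤ -u → ‖ell u N v - N / xi u * li v‖ ≤ C / N := by
  obtain ⟨C, hC, h⟩ := exists_norm_inv_sinh_sub_le hu
  have hs : Summable (fun n : ℕ => Real.exp (-u) ^ (n + 1)) :=
    (summable_nat_add_iff 1).mpr (summable_geometric_of_lt_one (by positivity)
      (by rw [Real.exp_lt_one_iff]; linarith))
  refine ⟨C * ∑' n : ℕ, Real.exp (-u) ^ (n + 1), ?_, fun N hN v hv => ?_⟩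
  · have := hs.tsum_pos (fun n => by positivity) 0 (by positivity)
    positivity
  have hN' : (0:ℝ) < N := by positivity
  rw [ell_sub_li hu hN (by linarith), show C * (∑' n : ℕ, Real.exp (-u) ^ (n + 1)) / N =
    C / N * ∑' n : ℕ, Real.exp (-u) ^ (n + 1) by ring]
  refine tsum_of_norm_bounded (hs.hasSum.mul_left _) fun n => ?_
  have h1 := h (((n:ℝ) + 1) / N) (by positivity)
  rw [norm_mul, norm_div, norm_natCast_add_one, norm_exp_succ_mul, ← Real.exp_nat_mul]
  have h3 : (((n:ℝ) + 1) / N) / (1 + (((n:ℝ) + 1) / N) ^ 2) ≤ ((n:ℝ) + 1) / N :=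
    div_le_self (by positivity) (by nlinarith [sq_nonneg (((n:ℝ) + 1) / N)])
  calc _ ≤ Real.exp (((n + 1 : ℕ):ℝ) * -u) / ((n:ℝ) + 1) * (C * (((n:ℝ) + 1) / N)) := by
        push_cast
        push_cast at h1
        gcongr
        exact h1.trans (by gcongr)
    _ = _ := by field_simp

/-- The quantum dilogarithm continued to the half plane `Re v < (k + 1/2) u / N`. -/
noncomputable def qdk (u : ℝ) (N k : ℕ) (v : ℂ) : ℂ :=
  (∏ j ∈ range k, (1 - exp (v - ((j:ℂ) + 1 / 2) * step u N))) * exp (-ell u N (v - k * step u N))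

lemma qdk_zero (u : ℝ) (N : ℕ) (v : ℂ) : qdk u N 0 v = exp (-ell u N v) := by
  simp [qdk]

lemma natCast_mul_step_re (u : ℝ) (N k : ℕ) : ((k:ℂ) * step u N).re = k * (u / N) := by
  rw [← ofReal_natCast, re_ofReal_mul, step_re]

lemma natCast_add_half_mul_step_re (u : ℝ) (N k : ℕ) :
    (((k:ℂ) + 1 / 2) * step u N).re = (k + 1 / 2) * (u / N) := by
  rw [show (k:ℂ) + 1 / 2 = (((k:ℝ) + 1 / 2 : ℝ) : ℂ) by push_cast; rfl, re_ofReal_mul, step_re]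

lemma qdk_succ {u : ℝ} (hu : 0 < u) {N : ℕ} (hN : N ≠ 0) (k : ℕ) {v : ℂ}
    (hv : v.re < (k + 1 / 2) * (u / N)) : qdk u N (k + 1) v = qdk u N k v := by
  have h := exp_neg_ell_add hu hN (v := v - ((k:ℂ) + 1 / 2) * step u N)
    (by rw [sub_re, natCast_add_half_mul_step_re]; linarith)
  rw [qdk, qdk, prod_range_succ, mul_assoc]
  congr 1
  rw [show v - (k:ℂ) * step u N = v - ((k:ℂ) + 1 / 2) * step u N + step u N / 2 by ring, h]
  congr 4
  push_cast
  ring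

lemma qdk_eq {u : ℝ} (hu : 0 < u) {N : ℕ} (hN : N ≠ 0) {k m : ℕ} (hkm : k ≤ m) {v : ℂ}
    (hv : v.re < (k + 1 / 2) * (u / N)) : qdk u N m v = qdk u N k v := by
  induction m, hkm using Nat.le_induction with
  | base => rfl
  | succ m hm ih =>
    rw [qdk_succ hu hN m (hv.trans_le _), ih]
    gcongr

lemma qdk_succ_add_step (u : ℝ) (N k : ℕ) (v : ℂ) :
    qdk u N (k + 1) (v + step u N) = (1 - exp (v + step u N / 2)) * qdk u N k v := by
  rw [qdk, qdk, prod_range_succ']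
  rw [show v + step u N - ((k + 1 : ℕ):ℂ) * step u N = v - k * step u N by push_cast; ring]
  rw [show v + step u N - (((0:ℕ):ℂ) + 1 / 2) * step u N = v + step u N / 2 by push_cast; ring]
  have : ∀ j : ℕ, v + step u N - (((j + 1 : ℕ):ℂ) + 1 / 2) * step u N =
    v - ((j:ℂ) + 1 / 2) * step u N := fun j => by push_cast; ring
  simp_rw [this]
  ring

/-- The interpolating function of the summands of the colored Jones polynomial. -/
noncomputable def gfun (u : ℝ) (N : ℕ) (y : ℂ) : ℂ :=
  exp (-u / 2 + N / xi u * (u * y)) * qdk u N N (y - u) * exp (ell u N (-u - y))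

lemma exp_mul_one_sub_mul (u x : ℂ) : exp u * (1 - exp (x - u)) * (1 - exp (-u - x)) =
    exp u + exp (-u) - exp x - exp (-x) := by
  rw [sub_eq_add_neg x u, sub_eq_add_neg (-u) x, Complex.exp_add, Complex.exp_add, Complex.exp_neg,
    Complex.exp_neg]
  have a := Complex.exp_ne_zero u
  have b := Complex.exp_ne_zero x
  field_simp
  ring

lemma gfun_add_step {u : ℝ} (hu : 0 < u) {N : ℕ} (hN : N ≠ 0) {y : ℂ} (h1 : 0 ≤ y.re)
    (h2 : y.re < 2 * u - u / (2 * N)) :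
    gfun u N (y + step u N) = (exp u + exp (-u) - exp (y + step u N / 2) -
      exp (-(y + step u N / 2))) * gfun u N y := by
  have hp : 0 < u / (2 * N) := by positivity
  obtain ⟨M, rfl⟩ := Nat.exists_eq_succ_of_ne_zero hN
  rw [gfun, gfun, show y + step u (M + 1) - u = (y - u) + step u (M + 1) by ring,
    qdk_succ_add_step]
  have hk := qdk_succ hu hN M (v := y - u) (by
    have : u = ((M:ℝ) + 1) * (u / ((M + 1 : ℕ):ℝ)) := by push_cast; field_simp
    have e : u / ((M + 1 : ℕ):ℝ) = 2 * (u / (2 * ((M + 1 : ℕ):ℝ))) := by field_simp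
    simp only [sub_re, ofReal_re]
    rw [Nat.succ_eq_add_one] at h2
    nlinarith)
  rw [hk]
  have hre : (step u (M + 1) / 2).re = u / (2 * ((M + 1 : ℕ):ℝ)) := by
    rw [show (2:ℂ) = ((2:ℝ):ℂ) by norm_num, div_ofReal_re, step_re]
    field_simp
  have h := exp_neg_ell_add hu hN (v := -u - y - step u (M + 1) / 2)
    (by simp only [sub_re, neg_re, ofReal_re, hre]; linarith)
  rw [show -(u:ℂ) - y - step u (M + 1) / 2 + step u (M + 1) / 2 = -u - y by ring,
    show -(u:ℂ) - y - step u (M + 1) / 2 - step u (M + 1) / 2 = -u - (y + step u (M + 1)) by ring,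
    Complex.exp_neg, Complex.exp_neg] at h
  have hE : exp (ell u (M + 1) (-u - (y + step u (M + 1)))) =
      (1 - exp (-u - y - step u (M + 1) / 2)) * exp (ell u (M + 1) (-u - y)) := by
    have a := Complex.exp_ne_zero (ell u (M + 1) (-u - (y + step u (M + 1))))
    have b := Complex.exp_ne_zero (ell u (M + 1) (-u - y))
    generalize exp (-u - y - step u (M + 1) / 2) = z at h ⊢
    field_simp at h
    linear_combination h
  rw [hE]
  have hx : ((M + 1 : ℕ):ℂ) / xi u * (u * (y + step u (M + 1))) =
      ((M + 1 : ℕ):ℂ) / xi u * (u * y) + u := by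
    have := xi_ne_zero u
    have h0 : ((M + 1 : ℕ):ℂ) ≠ 0 := by exact_mod_cast hN
    rw [step]
    field_simp
  rw [hx, ← add_assoc, Complex.exp_add _ (u:ℂ)]
  have e1 : exp (u:ℂ) * (1 - exp (y - u + step u (M + 1) / 2)) *
      (1 - exp (-u - y - step u (M + 1) / 2)) =
      exp u + exp (-u) - exp (y + step u (M + 1) / 2) - exp (-(y + step u (M + 1) / 2)) := by
    rw [← exp_mul_one_sub_mul]
    ring_nf
  rw [← e1]
  ring

lemma gfun_half_step {u : ℝ} (hu : 0 < u) {N : ℕ} (hN : N ≠ 0) :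
    gfun u N (step u N / 2) = 1 - exp (-u) := by
  have hp : 0 < u / (2 * N) := by positivity
  have hre : (step u N / 2).re = u / (2 * N) := by
    rw [show (2:ℂ) = ((2:ℝ):ℂ) by norm_num, div_ofReal_re, step_re]
    field_simp
  have h := exp_neg_ell_add hu hN (v := -u) (by simpa using hu)
  rw [gfun, qdk_eq hu hN N.zero_le, qdk_zero]
  · have hx : -u / 2 + (N:ℂ) / xi u * (u * (step u N / 2)) = 0 := by
      have := xi_ne_zero u
      have h0 : (N:ℂ) ≠ 0 := by exact_mod_cast hN
      rw [step]
      field_simp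
      ring
    rw [hx, show step u N / 2 - (u:ℂ) = -u + step u N / 2 by ring, h, Complex.exp_neg (ell _ _ _)]
    have b := Complex.exp_ne_zero (ell u N (-u - step u N / 2))
    field_simp
    simp
  · rw [sub_re, hre, ofReal_re]
    push_cast
    have e : u / N = 2 * (u / (2 * N)) := by field_simp
    linarith

lemma gfun_nodes {u : ℝ} (hu : 0 < u) {N : ℕ} (hN : N ≠ 0) {k : ℕ} (hk : k < N) :
    gfun u N (((k:ℂ) + 1 / 2) * step u N) = (1 - exp (-u)) *
      ∏ l ∈ Icc 1 k, (exp u + exp (-u) - exp (l * step u N) - exp (-(l * step u N))) := by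
  induction k with
  | zero =>
    rw [show (((0:ℕ):ℂ) + 1 / 2) * step u N = step u N / 2 by push_cast; ring, gfun_half_step hu hN]
    simp
  | succ k ih =>
    rw [show (((k + 1 : ℕ):ℂ) + 1 / 2) * step u N = ((k:ℂ) + 1 / 2) * step u N + step u N by
      push_cast; ring, gfun_add_step hu hN, ih (by omega), prod_Icc_succ_top (by omega),
      show ((k:ℂ) + 1 / 2) * step u N + step u N / 2 = ((k + 1 : ℕ):ℂ) * step u N by
        push_cast; ring]
    · ring
    · rw [natCast_add_half_mul_step_re]; positivity
    · rw [natCast_add_half_mul_step_re]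
      have hp : 0 < u / (2 * N) := by positivity
      have e : u / N = 2 * (u / (2 * N)) := by field_simp
      have h3 : u = N * (u / N) := by field_simp
      have h4 : (k:ℝ) + 2 ≤ N := by exact_mod_cast hk
      have hq : 0 < u / N := by positivity
      nlinarith

lemma exp_xi (u : ℝ) : exp (xi u) = exp u := by
  rw [xi, Complex.exp_add, Complex.exp_two_pi_mul_I, mul_one]

lemma JE_mul_eq_sum {u : ℝ} (hu : 0 < u) {N : ℕ} (hN : 2 ≤ N) :
    JE N (exp (xi u / N)) * (1 - exp (-u)) =
      ∑ k ∈ range N, gfun u N (((k:ℂ) + 1 / 2) * step u N) := by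
  have hN0 : N ≠ 0 := by omega
  rw [JE, sum_mul]
  refine sum_congr rfl fun k hk => ?_
  rw [gfun_nodes hu hN0 (mem_range.mp hk), mul_comm]
  congr 1
  refine prod_congr rfl fun l _ => ?_
  have hlog : log (exp (step u N)) = step u N := by
    have hN' : (2:ℝ) ≤ N := by exact_mod_cast hN
    apply Complex.log_exp
    · rw [step_im]
      have : 0 < 2 * Real.pi / N := by positivity
      linarith [Real.pi_pos]
    · rw [step_im, div_le_iff₀ (by positivity)]
      nlinarith [Real.pi_pos]
  have hpow : ∀ a : ℂ, exp (xi u / N) ^ a = exp (step u N * a) := fun a => by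
    rw [← step, Complex.cpow_def_of_ne_zero (Complex.exp_ne_zero _), hlog]
  simp only [hpow]
  have hx := natCast_mul_step u hN0
  have e1 : exp (step u N * (((N:ℂ) - l) / 2)) * exp (step u N * (((N:ℂ) + l) / 2)) = exp u := by
    rw [← Complex.exp_add, ← exp_xi, ← hx]; ring_nf
  have e2 : exp (step u N * (-(((N:ℂ) - l) / 2))) * exp (step u N * (-(((N:ℂ) + l) / 2))) =
      exp (-u) := by
    rw [← Complex.exp_add, Complex.exp_neg (u:ℂ), ← exp_xi, ← Complex.exp_neg, ← hx]; ring_nf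
  have e3 : exp (step u N * (((N:ℂ) - l) / 2)) * exp (step u N * (-(((N:ℂ) + l) / 2))) =
      exp (-(l * step u N)) := by
    rw [← Complex.exp_add]; ring_nf
  have e4 : exp (step u N * (-(((N:ℂ) - l) / 2))) * exp (step u N * (((N:ℂ) + l) / 2)) =
      exp (l * step u N) := by
    rw [← Complex.exp_add]; ring_nf
  rw [← e1, ← e2, ← e3, ← e4]
  ring

lemma ell_add_two_pi (u : ℝ) (N : ℕ) (v : ℂ) : ell u N (v + 2 * Real.pi * I) = ell u N v := by
  rw [ell, ell]
  congr 1
  ext n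
  congr 1
  rw [mul_add, Complex.exp_add, show ((n:ℂ) + 1) * (2 * Real.pi * I) =
    ((n + 1 : ℕ):ℂ) * (2 * Real.pi * I) by push_cast; ring, Complex.exp_nat_mul_two_pi_mul_I,
    mul_one]

lemma exp_add_two_pi (v : ℂ) : exp (v + 2 * Real.pi * I) = exp v := by
  rw [Complex.exp_add, Complex.exp_two_pi_mul_I, mul_one]

lemma qdk_add_two_pi (u : ℝ) (N k : ℕ) (v : ℂ) :
    qdk u N k (v + 2 * Real.pi * I) = qdk u N k v := by
  rw [qdk, qdk, show v + 2 * Real.pi * I - k * step u N = v - k * step u N + 2 * Real.pi * I by ring,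
    ell_add_two_pi]
  congr 1
  refine prod_congr rfl fun j _ => ?_
  rw [show v + 2 * Real.pi * I - ((j:ℂ) + 1 / 2) * step u N =
    v - ((j:ℂ) + 1 / 2) * step u N + 2 * Real.pi * I by ring, exp_add_two_pi]

lemma gfun_add_two_pi (u : ℝ) (N : ℕ) (y : ℂ) :
    gfun u N (y + 2 * Real.pi * I) =
      exp (N / xi u * (u * (2 * Real.pi * I))) * gfun u N y := by
  rw [gfun, gfun, show y + 2 * Real.pi * I - u = y - u + 2 * Real.pi * I by ring, qdk_add_two_pi,
    ← ell_add_two_pi u N (-u - (y + 2 * Real.pi * I)),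
    show -u - (y + 2 * Real.pi * I) + 2 * Real.pi * I = -u - y by ring,
    show -(u:ℂ) / 2 + N / xi u * (u * (y + 2 * Real.pi * I)) =
      N / xi u * (u * (2 * Real.pi * I)) + (-u / 2 + N / xi u * (u * y)) by ring, Complex.exp_add]
  ring

lemma differentiableAt_gfun {u : ℝ} (hu : 0 < u) {N : ℕ} (hN : N ≠ 0) {y : ℂ}
    (h1 : 0 ≤ y.re) (h2 : y.re ≤ 2 * u) : DifferentiableAt ℂ (gfun u N) y := by
  have hp : 0 < u / (2 * N) := by positivity
  have d1 : DifferentiableAt ℂ (fun y : ℂ => ell u N (y - u - N * step u N)) y := by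
    apply DifferentiableAt.comp (g := ell u N) y (differentiableAt_ell hu hN _) (by fun_prop)
    rw [natCast_mul_step u hN]
    simp only [sub_re, ofReal_re, xi_re]
    linarith
  have d2 : DifferentiableAt ℂ (fun y : ℂ => ell u N (-u - y)) y := by
    apply DifferentiableAt.comp (g := ell u N) y (differentiableAt_ell hu hN _) (by fun_prop)
    simp only [sub_re, neg_re, ofReal_re]
    linarith
  unfold gfun qdk
  fun_prop

/-- The counterclockwise integral over the boundary of the rectangle `[a, b] × [c, d]`. -/
noncomputable def rectInt (f : ℂ → ℂ) (a b c d : ℝ) : ℂ :=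
  (∫ x in a..b, f (x + c * I)) - (∫ x in a..b, f (x + d * I)) +
    I * (∫ y in c..d, f (b + y * I)) - I * (∫ y in c..d, f (a + y * I))

lemma integral_inv_path_of_slitPlane {a b : ℝ} {γ : ℝ → ℂ} {γ' : ℂ}
    (hγ : ∀ t, HasDerivAt γ γ' t) (h : ∀ t ∈ Set.uIcc a b, γ t ∈ slitPlane) :
    ∫ t in a..b, γ' / γ t = log (γ b) - log (γ a) := by
  have hc : Continuous γ := continuous_iff_continuousAt.mpr fun t => (hγ t).continuousAt
  apply intervalIntegral.integral_eq_sub_of_hasDerivAt (f := fun t => log (γ t))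
  · intro t ht
    exact (hγ t).clog_real (h t ht)
  · apply ContinuousOn.intervalIntegrable
    exact ContinuousOn.div continuousOn_const hc.continuousOn
      fun t ht => slitPlane_ne_zero (h t ht)

lemma rectInt_inv {a b c d : ℝ} (ha : a < 0) (hb : 0 < b) (hc : c < 0) (hd : 0 < d) :
    rectInt (fun z => 1 / z) a b c d = 2 * Real.pi * I := by
  have h1 : ∀ e : ℝ, ∀ t : ℝ, HasDerivAt (fun x : ℝ => (x:ℂ) + e * I) 1 t := fun e t => by
    simpa using (HasDerivAt.ofReal_comp (hasDerivAt_id t)).add_const ((e:ℂ) * I)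
  have h2 : ∀ e : ℝ, ∀ t : ℝ, HasDerivAt (fun y : ℝ => (e:ℂ) + y * I) I t := fun e t => by
    simpa using ((HasDerivAt.ofReal_comp (hasDerivAt_id t)).mul_const I).const_add (e:ℂ)
  have h3 : ∀ t : ℝ, HasDerivAt (fun y : ℝ => -((a:ℂ) + y * I)) (-I) t := fun t => (h2 a t).neg
  have A : ∫ x in a..b, 1 / ((x:ℂ) + c * I) = log (b + c * I) - log (a + c * I) :=
    integral_inv_path_of_slitPlane (h1 c) fun t _ => Or.inr (by simpa using hc.ne)
  have B : ∫ x in a..b, 1 / ((x:ℂ) + d * I) = log (b + d * I) - log (a + d * I) :=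
    integral_inv_path_of_slitPlane (h1 d) fun t _ => Or.inr (by simpa using hd.ne')
  have C : ∫ y in c..d, I / ((b:ℂ) + y * I) = log (b + d * I) - log (b + c * I) :=
    integral_inv_path_of_slitPlane (h2 b) fun t _ => Or.inl (by simpa using hb)
  have D : ∫ y in c..d, -I / -((a:ℂ) + y * I) = log (-(a + d * I)) - log (-(a + c * I)) :=
    integral_inv_path_of_slitPlane h3 fun t _ => Or.inl (by simpa using ha)
  have C' : I * ∫ y in c..d, 1 / ((b:ℂ) + y * I) = log (b + d * I) - log (b + c * I) := by
    rw [← C, ← intervalIntegral.integral_const_mul]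
    simp only [mul_one_div]
  have D' : I * ∫ y in c..d, 1 / ((a:ℂ) + y * I) = log (-(a + d * I)) - log (-(a + c * I)) := by
    rw [← D, ← intervalIntegral.integral_const_mul]
    simp only [mul_one_div, neg_div_neg_eq]
  rw [rectInt, A, B, C', D']
  have n1 : log (-(a + d * I)) = log (a + d * I) - Real.pi * I := by
    rw [Complex.log, Complex.log, norm_neg, Complex.arg_neg_eq_arg_sub_pi_of_im_pos (by simpa)]
    push_cast; ring
  have n2 : log (-(a + c * I)) = log (a + c * I) + Real.pi * I := by
    rw [Complex.log, Complex.log, norm_neg, Complex.arg_neg_eq_arg_add_pi_of_im_neg (by simpa)]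
    push_cast; ring
  rw [n1, n2]
  ring

lemma rectInt_eq_zero {f : ℂ → ℂ} {a b c d : ℝ}
    (H : DifferentiableOn ℂ f (Set.uIcc a b ×ℂ Set.uIcc c d)) : rectInt f a b c d = 0 := by
  have := Complex.integral_boundary_rect_eq_zero_of_differentiableOn f (a + c * I) (b + d * I)
    (by simpa using H)
  simpa [rectInt] using this

lemma rectInt_congr {f g : ℂ → ℂ} {a b c d : ℝ}
    (h1 : ∀ x ∈ Set.uIcc a b, f (x + c * I) = g (x + c * I))
    (h2 : ∀ x ∈ Set.uIcc a b, f (x + d * I) = g (x + d * I))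
    (h3 : ∀ y ∈ Set.uIcc c d, f (b + y * I) = g (b + y * I))
    (h4 : ∀ y ∈ Set.uIcc c d, f (a + y * I) = g (a + y * I)) :
    rectInt f a b c d = rectInt g a b c d := by
  rw [rectInt, rectInt, intervalIntegral.integral_congr h1, intervalIntegral.integral_congr h2,
    intervalIntegral.integral_congr h3, intervalIntegral.integral_congr h4]

lemma rectInt_translate (f : ℂ → ℂ) (a b c d p q : ℝ) :
    rectInt (fun z => f (z - (p + q * I))) a b c d =
      rectInt f (a - p) (b - p) (c - q) (d - q) := by
  have e1 : ∀ e x : ℝ, (x:ℂ) + e * I - (p + q * I) = ((x - p : ℝ):ℂ) + ((e - q : ℝ):ℂ) * I :=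
    fun e x => by push_cast; ring
  simp only [rectInt, e1]
  rw [intervalIntegral.integral_comp_sub_right (fun x : ℝ => f (x + ((c - q : ℝ):ℂ) * I)),
    intervalIntegral.integral_comp_sub_right (fun x : ℝ => f (x + ((d - q : ℝ):ℂ) * I)),
    intervalIntegral.integral_comp_sub_right (fun y : ℝ => f (((b - p : ℝ):ℂ) + y * I)),
    intervalIntegral.integral_comp_sub_right (fun y : ℝ => f (((a - p : ℝ):ℂ) + y * I))]

lemma rectInt_cauchy {g : ℂ → ℂ} {a b c d : ℝ} {w : ℂ} (ha : a < w.re) (hb : w.re < b)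
    (hc : c < w.im) (hd : w.im < d) (H : DifferentiableOn ℂ g (Set.Icc a b ×ℂ Set.Icc c d)) :
    rectInt (fun z => g z / (z - w)) a b c d = 2 * Real.pi * I * g w := by
  have hab := (ha.trans hb).le
  have hcd := (hc.trans hd).le
  have hnhds : (Set.Icc a b ×ℂ Set.Icc c d) ∈ 𝓝 w := by
    refine mem_of_superset (IsOpen.mem_nhds ((isOpen_Ioo (a := a) (b := b)).reProdIm
      (isOpen_Ioo (a := c) (b := d))) ⟨⟨ha, hb⟩, ⟨hc, hd⟩⟩) ?_
    exact fun z hz => ⟨Set.Ioo_subset_Icc_self hz.1, Set.Ioo_subset_Icc_self hz.2⟩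
  have hds := (Complex.differentiableOn_dslope hnhds).mpr H
  have h0 := rectInt_eq_zero (a := a) (b := b) (c := c) (d := d) (f := dslope g w)
    (by rwa [Set.uIcc_of_le hab, Set.uIcc_of_le hcd])
  have hinv : rectInt (fun z => 1 / (z - w)) a b c d = 2 * Real.pi * I := by
    have := rectInt_translate (fun z => 1 / z) a b c d w.re w.im
    rw [Complex.re_add_im] at this
    rw [this, rectInt_inv] <;> linarith
  have ne1 : ∀ x : ℝ, (x:ℂ) + c * I ≠ w := fun x h => hc.ne (by rw [← h]; simp)
  have ne2 : ∀ x : ℝ, (x:ℂ) + d * I ≠ w := fun x h => hd.ne' (by rw [← h]; simp)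
  have ne3 : ∀ y : ℝ, (b:ℂ) + y * I ≠ w := fun x h => hb.ne' (by rw [← h]; simp)
  have ne4 : ∀ y : ℝ, (a:ℂ) + y * I ≠ w := fun x h => ha.ne (by rw [← h]; simp)
  have key : ∀ z, z ≠ w → g z / (z - w) = dslope g w z + g w * (1 / (z - w)) := fun z hz => by
    rw [dslope_of_ne _ hz, slope_def_field]
    ring
  have e : rectInt (fun z => g z / (z - w)) a b c d =
      rectInt (fun z => dslope g w z + g w * (1 / (z - w))) a b c d :=
    rectInt_congr (fun x _ => key _ (ne1 x)) (fun x _ => key _ (ne2 x)) (fun x _ => key _ (ne3 x))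
      (fun x _ => key _ (ne4 x))
  have int1 : ∀ e : ℝ, e ∈ Set.Icc c d →
      IntervalIntegrable (fun x : ℝ => dslope g w (x + e * I)) volume a b := fun e he => by
    apply ContinuousOn.intervalIntegrable
    rw [Set.uIcc_of_le hab]
    refine hds.continuousOn.comp (by fun_prop) fun x hx => ?_
    exact ⟨by simpa using hx, by simpa using he⟩
  have int2 : ∀ e : ℝ, e ∈ Set.Icc a b →
      IntervalIntegrable (fun y : ℝ => dslope g w (e + y * I)) volume c d := fun e he => by
    apply ContinuousOn.intervalIntegrable
    rw [Set.uIcc_of_le hcd]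
    refine hds.continuousOn.comp (by fun_prop) fun x hx => ?_
    exact ⟨by simpa using he, by simpa using hx⟩
  have int3 : ∀ e : ℝ, (∀ x : ℝ, (x:ℂ) + e * I ≠ w) →
      IntervalIntegrable (fun x : ℝ => g w * (1 / ((x:ℂ) + e * I - w))) volume a b := fun e he => by
    apply Continuous.intervalIntegrable
    exact continuous_const.mul (continuous_const.div (by fun_prop) fun x => sub_ne_zero.mpr (he x))
  have int4 : ∀ e : ℝ, (∀ y : ℝ, (e:ℂ) + y * I ≠ w) →
      IntervalIntegrable (fun y : ℝ => g w * (1 / ((e:ℂ) + y * I - w))) volume c d := fun e he => by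
    apply Continuous.intervalIntegrable
    exact continuous_const.mul (continuous_const.div (by fun_prop) fun x => sub_ne_zero.mpr (he x))
  rw [e, rectInt, intervalIntegral.integral_add (int1 c ⟨le_rfl, hcd⟩) (int3 c ne1),
    intervalIntegral.integral_add (int1 d ⟨hcd, le_rfl⟩) (int3 d ne2),
    intervalIntegral.integral_add (int2 b ⟨hab, le_rfl⟩) (int4 b ne3),
    intervalIntegral.integral_add (int2 a ⟨le_rfl, hab⟩) (int4 a ne4),
    intervalIntegral.integral_const_mul, intervalIntegral.integral_const_mul,
    intervalIntegral.integral_const_mul, intervalIntegral.integral_const_mul]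
  rw [rectInt] at h0 hinv
  linear_combination h0 + g w * hinv

/-- `e^{2πi N y/ξ}`, equal to `-1` exactly at the nodes. -/
noncomputable def efun (u : ℝ) (N : ℕ) (y : ℂ) : ℂ := exp (2 * Real.pi * I * (N / xi u * y))

lemma efun_eq_one {u : ℝ} {N : ℕ} (hN : N ≠ 0) {y : ℂ} (h : efun u N y = 1) :
    ∃ n : ℤ, y = n * step u N := by
  obtain ⟨n, hn⟩ := Complex.exp_eq_one_iff.mp h
  refine ⟨n, ?_⟩
  have hx := xi_ne_zero u
  have hN' : (N:ℂ) ≠ 0 := by exact_mod_cast hN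
  have hpi : (2 * Real.pi * I : ℂ) ≠ 0 := Complex.two_pi_I_ne_zero
  have : (N:ℂ) / xi u * y = n := mul_left_cancel₀ hpi (by rw [hn]; ring)
  rw [step, ← this]
  field_simp

lemma efun_add_half {u : ℝ} {N : ℕ} (hN : N ≠ 0) (y : ℂ) (k : ℕ) :
    efun u N (y + ((k:ℂ) + 1 / 2) * step u N) = -efun u N y := by
  have hx := xi_ne_zero u
  have hN' : (N:ℂ) ≠ 0 := by exact_mod_cast hN
  have : 2 * Real.pi * I * (N / xi u * (y + ((k:ℂ) + 1 / 2) * step u N)) =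
      2 * Real.pi * I * (N / xi u * y) + k * (2 * Real.pi * I) + Real.pi * I := by
    rw [step]; field_simp; ring
  rw [efun, this, Complex.exp_add, Complex.exp_add, Complex.exp_nat_mul_two_pi_mul_I,
    Complex.exp_pi_mul_I, efun]
  ring

lemma one_add_efun_eq_zero {u : ℝ} {N : ℕ} (hN : N ≠ 0) {y : ℂ} (h : 1 + efun u N y = 0) :
    ∃ n : ℤ, y = ((n:ℂ) + 1 / 2) * step u N := by
  have := efun_add_half (u := u) hN (y - (((0:ℕ):ℂ) + 1 / 2) * step u N) 0
  rw [sub_add_cancel] at this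
  obtain ⟨n, hn⟩ := efun_eq_one (u := u) hN (y := y - (((0:ℕ):ℂ) + 1 / 2) * step u N)
    (by linear_combination this - h)
  refine ⟨n, ?_⟩
  push_cast at hn
  linear_combination hn

/-- The integrand of the contour integral representing the colored Jones polynomial. -/
noncomputable def kfun (u : ℝ) (N : ℕ) (y : ℂ) : ℂ := gfun u N y / (1 + efun u N y)

lemma int_add_half_mul_step_re (u : ℝ) (N : ℕ) (n : ℤ) :
    (((n:ℂ) + 1 / 2) * step u N).re = (n + 1 / 2) * (u / N) := by
  rw [show (n:ℂ) + 1 / 2 = (((n:ℝ) + 1 / 2 : ℝ) : ℂ) by push_cast; rfl, re_ofReal_mul, step_re]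

lemma int_add_half_mul_step_im (u : ℝ) (N : ℕ) (n : ℤ) :
    (((n:ℂ) + 1 / 2) * step u N).im = (n + 1 / 2) * (2 * Real.pi / N) := by
  rw [show (n:ℂ) + 1 / 2 = (((n:ℝ) + 1 / 2 : ℝ) : ℂ) by push_cast; rfl, im_ofReal_mul, step_im]

lemma one_add_efun_ne_zero_of_re {u : ℝ} (hu : 0 < u) {N : ℕ} (hN : N ≠ 0) (m : ℤ) {y : ℂ}
    (hy : y.re = m * u) : 1 + efun u N y ≠ 0 := by
  intro h
  obtain ⟨n, rfl⟩ := one_add_efun_eq_zero hN h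
  rw [int_add_half_mul_step_re] at hy
  have hN' : (0:ℝ) < N := by positivity
  field_simp at hy
  have : (2 * n + 1 : ℤ) = 2 * (m * N) := by
    have : (2 * (n:ℝ) + 1) = 2 * (m * N) := by linarith
    exact_mod_cast this
  omega

lemma differentiable_efun (u : ℝ) (N : ℕ) : Differentiable ℂ (efun u N) := by
  unfold efun; fun_prop

lemma continuousAt_kfun {u : ℝ} (hu : 0 < u) {N : ℕ} (hN : N ≠ 0) {y : ℂ}
    (h1 : 0 ≤ y.re) (h2 : y.re ≤ 2 * u) (h : 1 + efun u N y ≠ 0) :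
    ContinuousAt (kfun u N) y :=
  (differentiableAt_gfun hu hN h1 h2).continuousAt.div
    (continuousAt_const.add (differentiable_efun u N).continuous.continuousAt) h

lemma rectInt_kfun {u : ℝ} (hu : 0 < u) {N : ℕ} (hN : N ≠ 0) {k : ℕ} (hk : k < N) :
    rectInt (kfun u N) 0 (2 * u) (k * (2 * Real.pi / N)) ((k + 1 : ℕ) * (2 * Real.pi / N)) =
      -(xi u / N) * gfun u N (((k:ℂ) + 1 / 2) * step u N) := by
  have hN' : (0:ℝ) < N := by positivity
  have hx := xi_ne_zero u
  have hNc : (N:ℂ) ≠ 0 := by exact_mod_cast hN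
  set w := ((k:ℂ) + 1 / 2) * step u N
  have hwre : w.re = (k + 1 / 2) * (u / N) := natCast_add_half_mul_step_re u N k
  have hwim : w.im = (k + 1 / 2) * (2 * Real.pi / N) := by
    have := int_add_half_mul_step_im u N k
    simp only [Int.cast_natCast] at this
    exact this
  have hpN : 0 < 2 * Real.pi / N := by positivity
  set L : ℂ := 2 * Real.pi * I * (N / xi u)
  have hL : L ≠ 0 := mul_ne_zero Complex.two_pi_I_ne_zero (div_ne_zero hNc hx)
  set q : ℂ → ℂ := dslope exp 0
  have hqd : Differentiable ℂ q := by
    rw [← differentiableOn_univ, Complex.differentiableOn_dslope univ_mem, differentiableOn_univ]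
    exact Complex.differentiable_exp
  have hq : ∀ z : ℂ, exp z - 1 = z * q z := fun z => by
    have := sub_smul_dslope exp 0 z
    simp only [sub_zero, smul_eq_mul, Complex.exp_zero] at this
    exact this.symm
  have hE : ∀ y : ℂ, 1 + efun u N y = -((y - w) * (L * q (L * (y - w)))) := fun y => by
    have h1 := efun_add_half (u := u) hN (y - w) k
    rw [sub_add_cancel] at h1
    have h2 := hq (L * (y - w))
    have h3 : efun u N (y - w) = exp (L * (y - w)) := by
      rw [efun]; congr 1; simp only [L]; ring
    rw [h1, h3]
    linear_combination -h2
  have hq0 : ∀ y : ℂ, y.im ∈ Set.Icc (k * (2 * Real.pi / N)) ((k + 1 : ℕ) * (2 * Real.pi / N)) →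
      q (L * (y - w)) ≠ 0 := by
    intro y hy h
    have h1 : 1 + efun u N y = 0 := by rw [hE, h]; ring
    obtain ⟨n, hn⟩ := one_add_efun_eq_zero hN h1
    have him := int_add_half_mul_step_im u N n
    rw [← hn] at him
    rw [him] at hy
    have a1 := le_of_mul_le_mul_right hy.1 hpN
    have a2 := le_of_mul_le_mul_right hy.2 hpN
    have b1 : (k:ℤ) < n + 1 := by
      have : ((k:ℤ):ℝ) < ((n + 1 : ℤ) : ℝ) := by push_cast; linarith
      exact_mod_cast this
    have b2 : n < k + 1 := by
      have : (n:ℝ) < ((k + 1 : ℤ) : ℝ) := by push_cast at a2 ⊢; linarith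
      exact_mod_cast this
    have : n = k := by omega
    subst this
    have hyw : y - w = 0 := by rw [hn]; simp [w]
    rw [hyw, mul_zero] at h
    simp [q] at h
  set g : ℂ → ℂ := fun y => -(gfun u N y / (L * q (L * (y - w))))
  have hg : DifferentiableOn ℂ g (Set.Icc 0 (2 * u) ×ℂ
      Set.Icc (k * (2 * Real.pi / N)) ((k + 1 : ℕ) * (2 * Real.pi / N))) := by
    intro y hy
    refine DifferentiableAt.differentiableWithinAt ?_
    have d : DifferentiableAt ℂ (fun y => L * q (L * (y - w))) y :=
      (differentiableAt_const L).mul (DifferentiableAt.comp (g := q) y (hqd _) (by fun_prop))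
    exact ((differentiableAt_gfun hu hN hy.1.1 hy.1.2).div d (mul_ne_zero hL (hq0 y hy.2))).neg
  have hk' : ((k:ℝ) + 1) ≤ N := by exact_mod_cast hk
  have hu' : u = N * (u / N) := by field_simp
  have huN : 0 < u / N := by positivity
  have hcauchy := rectInt_cauchy (w := w) (by rw [hwre]; positivity) (by rw [hwre]; nlinarith)
    (by rw [hwim]; nlinarith) (by rw [hwim]; push_cast; nlinarith) hg
  have hfun : kfun u N = fun z => g z / (z - w) := by
    ext z
    rw [kfun, hE]
    simp only [g]
    rw [neg_div, div_div, div_neg, mul_comm (z - w)]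
  rw [hfun, hcauchy]
  simp only [g, sub_self, mul_zero]
  have : q 0 = 1 := by simp [q]
  rw [this]
  simp only [L]
  have := Complex.two_pi_I_ne_zero
  field_simp

lemma sum_gfun_nodes {u : ℝ} (hu : 0 < u) {N : ℕ} (hN : N ≠ 0) :
    ∑ k ∈ range N, gfun u N (((k:ℂ) + 1 / 2) * step u N) =
      -(N / xi u) * rectInt (kfun u N) 0 (2 * u) 0 (2 * Real.pi) := by
  have hx := xi_ne_zero u
  have hNc : (N:ℂ) ≠ 0 := by exact_mod_cast hN
  have hterm : ∀ k ∈ range N, gfun u N (((k:ℂ) + 1 / 2) * step u N) = -(N / xi u) *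
      rectInt (kfun u N) 0 (2 * u) (k * (2 * Real.pi / N)) ((k + 1 : ℕ) * (2 * Real.pi / N)) := by
    intro k hk
    rw [rectInt_kfun hu hN (mem_range.mp hk)]
    field_simp
  rw [sum_congr rfl hterm, ← mul_sum]
  congr 1
  simp only [rectInt]
  have hv : ∀ m : ℤ, 0 ≤ m → m ≤ 2 → ∀ s t : ℝ,
      IntervalIntegrable (fun y : ℝ => kfun u N (((m * u : ℝ):ℂ) + y * I)) volume s t := by
    intro m h0 h2 s t
    apply Continuous.intervalIntegrable
    rw [continuous_iff_continuousAt]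
    intro y
    have h0' : (0:ℝ) ≤ m := by exact_mod_cast h0
    have h2' : (m:ℝ) ≤ 2 := by exact_mod_cast h2
    refine ContinuousAt.comp (g := kfun u N) (continuousAt_kfun hu hN ?_ ?_ ?_) (by fun_prop)
    · simp; positivity
    · simp; gcongr
    · exact one_add_efun_ne_zero_of_re hu hN m (by simp)
  have V : ∀ m : ℤ, 0 ≤ m → m ≤ 2 → ∑ k ∈ range N,
      ∫ y in (k * (2 * Real.pi / N))..((k + 1 : ℕ) * (2 * Real.pi / N)),
        kfun u N (((m * u : ℝ):ℂ) + y * I) =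
      ∫ y in (0:ℝ)..(2 * Real.pi), kfun u N (((m * u : ℝ):ℂ) + y * I) := by
    intro m h0 h2
    rw [intervalIntegral.sum_integral_adjacent_intervals
      (a := fun k : ℕ => (k:ℝ) * (2 * Real.pi / N)) (fun k _ => hv m h0 h2 _ _)]
    have : (N:ℝ) ≠ 0 := by exact_mod_cast hN
    congr 1
    · simp
    · field_simp
  have V0 := V 0 le_rfl (by norm_num)
  have V2 := V 2 (by norm_num) le_rfl
  simp only [Int.cast_zero, zero_mul, Int.cast_ofNat] at V0 V2
  rw [sum_sub_distrib, sum_add_distrib, ← mul_sum, ← mul_sum, V0, V2,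
    sum_range_sub' (fun k : ℕ => ∫ x in (0:ℝ)..(2 * u),
      kfun u N (x + ((k * (2 * Real.pi / N) : ℝ):ℂ) * I))]
  have : (N:ℝ) * (2 * Real.pi / N) = 2 * Real.pi := by
    have : (N:ℝ) ≠ 0 := by exact_mod_cast hN
    field_simp
  rw [this]
  simp

/-- The squared modulus of `ξ`. -/
noncomputable def xiSq (u : ℝ) : ℝ := u ^ 2 + 4 * Real.pi ^ 2

lemma xiSq_pos (u : ℝ) : 0 < xiSq u := by
  rw [xiSq]; positivity

lemma div_xi_eq (u : ℝ) (N : ℕ) :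
    (N:ℂ) / xi u = ((N / xiSq u : ℝ) : ℂ) * (u - 2 * Real.pi * I) := by
  have h : xi u * (u - 2 * Real.pi * I) = (xiSq u : ℂ) := by
    rw [xi, xiSq]; push_cast; ring_nf; rw [I_sq]; ring
  have hx := xi_ne_zero u
  have hR : (xiSq u : ℂ) ≠ 0 := by exact_mod_cast (xiSq_pos u).ne'
  push_cast
  field_simp
  rw [← h]
  ring

/-- The exponential growth rate of `|exp (N z / ξ)|`, up to the factor `|ξ|²`. -/
noncomputable def rate (u : ℝ) (z : ℂ) : ℝ := u * z.re + 2 * Real.pi * z.im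

lemma div_xi_mul_re (u : ℝ) (N : ℕ) (z : ℂ) :
    ((N:ℂ) / xi u * z).re = N / xiSq u * rate u z := by
  rw [div_xi_eq, mul_assoc, re_ofReal_mul, rate]
  simp

lemma rate_add (u : ℝ) (a b : ℂ) : rate u (a + b) = rate u a + rate u b := by
  simp [rate]; ring

lemma exists_abs_ell_re_sub_le {u : ℝ} (hu : 0 < u) : ∃ C : ℝ, 0 < C ∧ ∀ N : ℕ, N ≠ 0 →
    ∀ v : ℂ, v.re ≤ 0 → |(ell u N v).re - N / xiSq u * rate u (li v)| ≤ C := by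
  obtain ⟨C, hC, h⟩ := exists_norm_ell_sub_li_le hu
  refine ⟨C, hC, fun N hN v hv => ?_⟩
  rw [← div_xi_mul_re, ← sub_re]
  exact (abs_re_le_norm _).trans (h N hN v hv)

lemma li_ofReal_im (x : ℝ) : (li x).im = 0 := by
  have := li_conj (x:ℂ)
  rw [conj_ofReal] at this
  exact conj_eq_iff_im.mp this.symm

lemma li_add_two_pi (v : ℂ) : li (v + 2 * Real.pi * I) = li v := by
  rw [li, li]
  congr 1
  ext n
  congr 1
  rw [mul_add, Complex.exp_add, show ((n:ℂ) + 1) * (2 * Real.pi * I) =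
    ((n + 1 : ℕ):ℂ) * (2 * Real.pi * I) by push_cast; ring, Complex.exp_nat_mul_two_pi_mul_I,
    mul_one]

lemma continuousOn_li : ContinuousOn li {v : ℂ | v.re ≤ 0} := by
  obtain ⟨K, hK, h⟩ := exists_norm_li_sub_le
  intro a ha
  rw [ContinuousWithinAt, tendsto_iff_norm_sub_tendsto_zero]
  have : Tendsto (fun b : ℂ => K * √‖b - a‖) (𝓝[{v : ℂ | v.re ≤ 0}] a) (𝓝 0) := by
    have : ContinuousAt (fun b : ℂ => K * √‖b - a‖) a := by fun_prop
    have h1 := this.tendsto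
    simp only [sub_self, norm_zero, Real.sqrt_zero, mul_zero] at h1
    exact h1.mono_left nhdsWithin_le_nhds
  exact squeeze_zero' (Eventually.of_forall fun _ => norm_nonneg _)
    (eventually_nhdsWithin_of_forall fun b hb => h b a hb ha) this

lemma hasDerivAt_li_ofReal_re {x : ℝ} (hx : x < 0) :
    HasDerivAt (fun x : ℝ => (li x).re) (-Real.log (1 - Real.exp x)) x := by
  have h := (hasDerivAt_li (v := x) (by simpa using hx)).real_of_complex
  have e : (-log (1 - exp (x:ℂ))).re = -Real.log (1 - Real.exp x) := by
    rw [← ofReal_exp, ← ofReal_one, ← ofReal_sub, neg_re, Complex.log_ofReal_re]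
  rwa [e] at h

lemma li_ofReal_re_mono {x y : ℝ} (hxy : x ≤ y) (hy : y ≤ 0) : (li x).re ≤ (li y).re := by
  have hc : ContinuousOn (fun x : ℝ => (li x).re) (Set.Iic 0) :=
    continuous_re.comp_continuousOn (continuousOn_li.comp (by fun_prop) fun x hx => by simpa using hx)
  refine monotoneOn_of_deriv_nonneg (convex_Iic 0) hc ?_ ?_ (hxy.trans hy) hy hxy
  · intro x hx
    rw [interior_Iic] at hx
    exact (hasDerivAt_li_ofReal_re hx).differentiableAt.differentiableWithinAt
  · intro x hx
    rw [interior_Iic] at hx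
    rw [(hasDerivAt_li_ofReal_re hx).deriv, neg_nonneg]
    have h1 : Real.exp x < 1 := Real.exp_lt_one_iff.mpr hx
    exact Real.log_nonpos (by linarith) (by linarith [Real.exp_pos x])

lemma li_ofReal_re_le {x : ℝ} (hx : x ≤ 0) : (li x).re ≤ Real.pi ^ 2 / 6 :=
  (re_le_norm _).trans (norm_li_le (by simpa using hx))

/-- The growth rate of the integrand on the real axis is nonpositive up to `u`. -/
lemma real_rate_nonpos {u : ℝ} (hu : 0 < u) (hu3 : Real.exp u + Real.exp (-u) < 3) {s : ℝ}
    (h0 : 0 ≤ s) (h1 : s ≤ u) :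
    u * s + (li ((-u - s : ℝ) : ℂ)).re - (li ((s - u : ℝ) : ℂ)).re ≤ 0 := by
  set ψ : ℝ → ℝ := fun s => u * s + (li ((-u - s : ℝ) : ℂ)).re - (li ((s - u : ℝ) : ℂ)).re
  have hR : ContinuousOn (fun x : ℝ => (li x).re) (Set.Iic 0) :=
    continuous_re.comp_continuousOn (continuousOn_li.comp (by fun_prop) fun x hx => by simpa using hx)
  have hc : ContinuousOn ψ (Set.Icc 0 u) := by
    refine ContinuousOn.sub (ContinuousOn.add (by fun_prop) ?_) ?_
    · refine hR.comp (f := fun s : ℝ => -u - s) (by fun_prop) fun s hs => ?_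
      have := hs.1
      simp only [Set.mem_Iic]; linarith
    · refine hR.comp (f := fun s : ℝ => s - u) (by fun_prop) fun s hs => ?_
      have := hs.2
      simp only [Set.mem_Iic]; linarith
  have hd : ∀ s ∈ Set.Ioo 0 u, HasDerivAt ψ (u + Real.log (1 - Real.exp (-u - s)) +
      Real.log (1 - Real.exp (s - u))) s := by
    intro s hs
    have a := (hasDerivAt_li_ofReal_re (x := -u - s) (by linarith [hs.1])).comp_const_sub (-u) s
    have b := (hasDerivAt_li_ofReal_re (x := s - u) (by linarith [hs.2])).comp_sub_const s u
    have c := (((hasDerivAt_id s).const_mul u).add a).sub b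
    refine HasDerivAt.congr_deriv c ?_
    ring
  have hanti : AntitoneOn ψ (Set.Icc 0 u) := by
    refine antitoneOn_of_deriv_nonpos (convex_Icc 0 u) hc ?_ ?_
    · intro s hs
      rw [interior_Icc] at hs
      exact (hd s hs).differentiableAt.differentiableWithinAt
    · intro s hs
      rw [interior_Icc] at hs
      rw [(hd s hs).deriv]
      have p1 : 0 < 1 - Real.exp (-u - s) := by
        rw [sub_pos, Real.exp_lt_one_iff]; linarith [hs.1]
      have p2 : 0 < 1 - Real.exp (s - u) := by
        rw [sub_pos, Real.exp_lt_one_iff]; linarith [hs.2]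
      have e : u + Real.log (1 - Real.exp (-u - s)) + Real.log (1 - Real.exp (s - u)) =
          Real.log (Real.exp u + Real.exp (-u) - Real.exp s - Real.exp (-s)) := by
        have h := exp_mul_one_sub_mul (u:ℂ) (s:ℂ)
        have h' : Real.exp u * (1 - Real.exp (s - u)) * (1 - Real.exp (-u - s)) =
          Real.exp u + Real.exp (-u) - Real.exp s - Real.exp (-s) := by exact_mod_cast h
        rw [← h', Real.log_mul (by positivity) p1.ne', Real.log_mul (by positivity) p2.ne',
          Real.log_exp]
        ring
      rw [e]
      have q : 2 ≤ Real.exp s + Real.exp (-s) := by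
        have := Real.one_le_cosh s
        rw [Real.cosh_eq] at this
        linarith
      refine Real.log_nonpos ?_ (by linarith)
      have h := exp_mul_one_sub_mul (u:ℂ) (s:ℂ)
      have h' : Real.exp u * (1 - Real.exp (s - u)) * (1 - Real.exp (-u - s)) =
        Real.exp u + Real.exp (-u) - Real.exp s - Real.exp (-s) := by exact_mod_cast h
      rw [← h']
      positivity
  have := hanti ⟨le_rfl, hu.le⟩ ⟨h0, h1⟩ h0
  refine this.trans (le_of_eq ?_)
  simp [ψ]

lemma norm_gfun (u : ℝ) (N : ℕ) (y : ℂ) : ‖gfun u N y‖ =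
    Real.exp (-u / 2 + N / xiSq u * (u * rate u y) + (ell u N (-u - y)).re) *
      ‖qdk u N N (y - u)‖ := by
  rw [gfun, norm_mul, norm_mul, Complex.norm_exp, Complex.norm_exp, add_re,
    show (N:ℂ) / xi u * (u * y) = u * (N / xi u * y) by ring, re_ofReal_mul, div_xi_mul_re,
    Real.exp_add (_ + _)]
  have : (-(u:ℂ) / 2).re = -u / 2 := by
    rw [show (2:ℂ) = ((2:ℝ):ℂ) by norm_num, div_ofReal_re]; simp
  rw [this, show u * (N / xiSq u * rate u y) = N / xiSq u * (u * rate u y) by ring]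
  ring

lemma exists_norm_gfun_le_left {u : ℝ} (hu : 0 < u) (hu3 : Real.exp u + Real.exp (-u) < 3) :
    ∃ C : ℝ, 0 < C ∧ ∀ N : ℕ, N ≠ 0 → ∀ s : ℝ, 0 ≤ s → s ≤ u → ‖gfun u N s‖ ≤ Real.exp C := by
  obtain ⟨C, hC, h⟩ := exists_abs_ell_re_sub_le hu
  refine ⟨2 * C, by positivity, fun N hN s h0 h1 => ?_⟩
  have hp : 0 < u / N := by positivity
  rw [norm_gfun, qdk_eq hu hN N.zero_le (by
    simp only [sub_re, ofReal_re]; push_cast; linarith), qdk_zero, Complex.norm_exp,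
    ← Real.exp_add, Real.exp_le_exp]
  have a := abs_le.mp (h N hN (-u - s) (by simp; linarith))
  have b := abs_le.mp (h N hN (s - u) (by simp; linarith))
  have e := real_rate_nonpos hu hu3 h0 h1
  push_cast at e
  have ia := li_ofReal_im (-u - s)
  have ib := li_ofReal_im (s - u)
  push_cast at ia ib
  simp only [rate, ia, ib] at a b ⊢
  simp only [ofReal_re, ofReal_im, neg_re]
  have hN' : 0 ≤ N / xiSq u * u := mul_nonneg (div_nonneg (by positivity) (xiSq_pos u).le) hu.le
  have := mul_nonpos_of_nonneg_of_nonpos hN' e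
  nlinarith

lemma prod_one_sub_exp_mul_exp_neg_ell {u : ℝ} (hu : 0 < u) {N : ℕ} (hN : N ≠ 0) (k : ℕ) {w : ℂ}
    (hw : w.re + k * (u / N) ≤ 0) :
    (∏ j ∈ range k, (1 - exp (w + ((j:ℂ) + 1 / 2) * step u N))) * exp (-ell u N w) =
      exp (-ell u N (w + k * step u N)) := by
  have huN : 0 < u / N := by positivity
  induction k with
  | zero => simp
  | succ k ih =>
    push_cast at hw
    rw [prod_range_succ, mul_right_comm, ih (by linarith), mul_comm]
    have h := exp_neg_ell_add hu hN (v := w + ((k:ℂ) + 1 / 2) * step u N)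
      (by rw [add_re, natCast_add_half_mul_step_re]; linarith)
    rw [show w + ((k:ℂ) + 1 / 2) * step u N + step u N / 2 = w + ((k + 1 : ℕ):ℂ) * step u N by
      push_cast; ring,
      show w + ((k:ℂ) + 1 / 2) * step u N - step u N / 2 = w + k * step u N by ring] at h
    exact h.symm

lemma prod_one_sub_exp_reflect (u : ℝ) (N k : ℕ) (v : ℂ) :
    ∏ j ∈ range k, (1 - exp (v - ((j:ℂ) + 1 / 2) * step u N)) =
      (-1) ^ k * exp (k * v - k ^ 2 / 2 * step u N) *
        ∏ j ∈ range k, (1 - exp (-v + ((j:ℂ) + 1 / 2) * step u N)) := by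
  induction k with
  | zero => simp
  | succ k ih =>
    rw [prod_range_succ, prod_range_succ, ih]
    have e1 : exp (((k + 1 : ℕ):ℂ) * v - ((k + 1 : ℕ):ℂ) ^ 2 / 2 * step u N) =
        exp (k * v - k ^ 2 / 2 * step u N) * exp (v - ((k:ℂ) + 1 / 2) * step u N) := by
      rw [← Complex.exp_add]; congr 1; push_cast; ring
    have e2 : exp (v - ((k:ℂ) + 1 / 2) * step u N) * exp (-v + ((k:ℂ) + 1 / 2) * step u N) = 1 := by
      rw [← Complex.exp_add, ← Complex.exp_zero]; congr 1; ring
    rw [e1, pow_succ]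
    have key : ∀ X Y Z W : ℂ, Z * W = 1 → (-1) ^ k * X * Y * (1 - Z) =
        (-1) ^ k * -1 * (X * Z) * (Y * (1 - W)) := fun X Y Z W h => by
      linear_combination -((-1) ^ k * X * Y) * h
    exact key _ _ _ _ e2

lemma norm_prod_one_sub_exp {u : ℝ} (hu : 0 < u) {N : ℕ} (hN : N ≠ 0) (k : ℕ) {v : ℂ}
    (hv : k * (u / N) ≤ v.re) :
    ‖∏ j ∈ range k, (1 - exp (v - ((j:ℂ) + 1 / 2) * step u N))‖ =
      Real.exp (k * v.re - k ^ 2 / 2 * (u / N) - (ell u N (-v + k * step u N)).re +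
        (ell u N (-v)).re) := by
  have h := prod_one_sub_exp_mul_exp_neg_ell hu hN k (w := -v) (by rw [neg_re]; linarith)
  have h2 := congrArg norm h
  rw [norm_mul, Complex.norm_exp, Complex.norm_exp] at h2
  rw [prod_one_sub_exp_reflect, norm_mul, norm_mul, norm_pow, norm_neg, norm_one, one_pow, one_mul,
    Complex.norm_exp]
  have hre : ((k:ℂ) * v - k ^ 2 / 2 * step u N).re = k * v.re - k ^ 2 / 2 * (u / N) := by
    rw [sub_re, ← ofReal_natCast, re_ofReal_mul,
      show ((k:ℝ):ℂ) ^ 2 / 2 = (((k:ℝ) ^ 2 / 2 : ℝ) : ℂ) by push_cast; rfl, re_ofReal_mul, step_re]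
  have h3 : ‖∏ j ∈ range k, (1 - exp (-v + ((j:ℂ) + 1 / 2) * step u N))‖ =
      Real.exp (-(ell u N (-v + k * step u N)).re + (ell u N (-v)).re) := by
    rw [neg_re, neg_re, Real.exp_neg (ell u N (-v)).re] at h2
    rw [Real.exp_add, ← h2, mul_assoc, inv_mul_cancel₀ (Real.exp_ne_zero _), mul_one]
  rw [hre, h3, ← Real.exp_add]
  congr 1
  ring

lemma exists_nat_bracket {u : ℝ} (hu : 0 < u) {N : ℕ} (hN : N ≠ 0) {σ : ℝ} (h0 : 0 ≤ σ)
    (h1 : σ ≤ u) : ∃ k : ℕ, k < N ∧ k * (u / N) ≤ σ ∧ σ ≤ (k + 1) * (u / N) := by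
  have huN : 0 < u / N := by positivity
  have hN' : (0:ℝ) < N := by positivity
  rcases h1.eq_or_lt with rfl | h1
  · refine ⟨N - 1, by omega, ?_, ?_⟩
    · rw [Nat.cast_sub (by omega)]; push_cast
      have : (N:ℝ) * (σ / N) = σ := by field_simp
      nlinarith
    · rw [Nat.cast_sub (by omega)]; push_cast
      have : (N:ℝ) * (σ / N) = σ := by field_simp
      linarith
  · refine ⟨⌊σ / (u / N)⌋₊, ?_, ?_, ?_⟩
    · rw [Nat.floor_lt (by positivity), div_lt_iff₀ huN]
      have : (N:ℝ) * (u / N) = u := by field_simp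
      linarith
    · rw [← le_div_iff₀ huN]
      exact Nat.floor_le (by positivity)
    · rw [← div_le_iff₀ huN]
      exact (Nat.lt_floor_add_one _).le

lemma rate_right_le {u σ κ δ x y : ℝ} (hu : 0 < u) (hu1 : u < 1) (h0 : 0 ≤ σ) (hκ0 : 0 ≤ κ)
    (hκ1 : κ ≤ 1) (hz1 : u * κ ≤ σ) (hz2 : σ ≤ u * κ + δ)
    (hx : x ≤ Real.pi ^ 2 / 6 - u * u) (hy : y ≤ Real.pi ^ 2 / 6) :
    u * (u * (u + σ)) + xiSq u * (κ * σ - κ ^ 2 / 2 * u) + u * x + u * y -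
      u * (Real.pi ^ 2 / 3 - 2 * Real.pi ^ 2 * (κ * (1 - κ))) ≤
      4 * Real.pi ^ 2 * σ + xiSq u * δ := by
  have q0 : 9 ≤ Real.pi ^ 2 := by nlinarith [Real.pi_gt_three]
  rw [xiSq]
  generalize Real.pi ^ 2 = P at *
  have q1 := mul_le_mul_of_nonneg_left (add_le_add hx hy) hu.le
  have q2 : κ * σ - κ ^ 2 / 2 * u ≤ κ * σ / 2 + δ / 2 := by
    have e1 := mul_le_mul_of_nonneg_left hz2 hκ0
    have e2 : κ * δ ≤ 1 * δ := by gcongr; linarith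
    nlinarith
  have q3 := mul_le_mul_of_nonneg_left q2 (by positivity : 0 ≤ u ^ 2 + 4 * P)
  have q4 := mul_le_mul_of_nonneg_left (mul_le_mul_of_nonneg_right hz1 (sub_nonneg.mpr hκ1))
    (by positivity : 0 ≤ 2 * P)
  have q5 : u ^ 2 * σ ≤ 1 * σ := by
    gcongr; nlinarith
  have q6 : κ * (u ^ 2 * σ) ≤ 1 * (u ^ 2 * σ) := by gcongr
  have q7 : 9 * σ ≤ P * σ := by gcongr
  have q8 : 0 ≤ (u ^ 2 + 4 * P) * δ := by
    have : 0 ≤ δ := by linarith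
    positivity
  linarith

set_option maxHeartbeats 1000000 in
lemma exists_norm_gfun_le_right {u : ℝ} (hu : 0 < u) (hu1 : u < 1)
    (hu3 : Real.exp u + Real.exp (-u) < 3) :
    ∃ C : ℝ, 0 < C ∧ ∀ N : ℕ, N ≠ 0 → ∀ σ : ℝ, 0 ≤ σ → σ ≤ u →
      ‖gfun u N (u + σ)‖ ≤ Real.exp (C * √N + N / xiSq u * (4 * Real.pi ^ 2 * σ)) := by
  obtain ⟨C, hC, h⟩ := exists_abs_ell_re_sub_le hu
  obtain ⟨K, hK, hli⟩ := exists_norm_li_sub_le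
  have hR := xiSq_pos u
  set B : ℝ := 1 / xiSq u * (8 * (2 * K * √(1 + ‖xi u‖)))
  have hB : 0 ≤ B := by positivity
  refine ⟨4 * C + 3 + B, by positivity, fun N hN σ h0 h1 => ?_⟩
  have hN' : (0:ℝ) < N := by positivity
  have hN1 : (1:ℝ) ≤ N := by exact_mod_cast Nat.one_le_iff_ne_zero.mpr hN
  have huN : 0 < u / N := by positivity
  obtain ⟨k, hkN, hk1, hk2⟩ := exists_nat_bracket hu hN h0 h1
  have hk0 : (0:ℝ) ≤ k := k.cast_nonneg
  have hkN' : (k:ℝ) + 1 ≤ N := by exact_mod_cast hkN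
  have hsre := natCast_mul_step_re u N k
  have hsre' := natCast_mul_step_re u N (k + 1)
  set a : ℂ := -σ + k * step u N
  set b : ℂ := σ - ((k + 1 : ℕ):ℂ) * step u N
  have ha : a.re ≤ 0 := by simp only [a, add_re, hsre, neg_re, ofReal_re]; linarith
  have hb : b.re ≤ 0 := by
    simp only [b, sub_re, hsre', ofReal_re]; push_cast; linarith
  -- the continued dilogarithm
  have hqdk : ‖qdk u N N σ‖ ≤ Real.exp (k * σ - k ^ 2 / 2 * (u / N) - (ell u N a).re +
      (ell u N (-σ)).re + 2 - (ell u N b).re) := by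
    rw [qdk_eq hu hN (Nat.succ_le_of_lt hkN) (by rw [ofReal_re]; push_cast; linarith), qdk,
      prod_range_succ, norm_mul, norm_mul, norm_prod_one_sub_exp hu hN k (by rwa [ofReal_re]),
      Complex.norm_exp, ofReal_re, neg_re, sub_eq_add_neg _ (ell u N b).re, Real.exp_add _ (-_),
      Real.exp_add _ 2]
    have hfac : ‖1 - exp ((σ:ℂ) - ((k:ℂ) + 1 / 2) * step u N)‖ ≤ Real.exp 2 := by
      refine (norm_sub_le _ _).trans ?_
      rw [norm_one, Complex.norm_exp, sub_re, natCast_add_half_mul_step_re, ofReal_re]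
      have e1 : Real.exp (σ - (k + 1 / 2) * (u / N)) ≤ Real.exp 1 := by
        rw [Real.exp_le_exp]
        have : 0 ≤ ((k:ℝ) + 1 / 2) * (u / N) := by positivity
        linarith
      have e2 : Real.exp 2 = Real.exp 1 * Real.exp 1 := by rw [← Real.exp_add]; norm_num
      have e3 := Real.add_one_le_exp (1:ℝ)
      nlinarith
    gcongr
  rw [norm_gfun, show (u:ℂ) + σ - u = σ by ring]
  refine (mul_le_mul_of_nonneg_left hqdk (Real.exp_pos _).le).trans ?_
  rw [← Real.exp_add, Real.exp_le_exp]
  have A := abs_le.mp (h N hN (-u - (u + σ)) (by simp; linarith))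
  have A2 := abs_le.mp (h N hN a ha)
  have A3 := abs_le.mp (h N hN (-σ) (by simpa using h0))
  have A4 := abs_le.mp (h N hN b hb)
  -- comparison of the two boundary values with the imaginary axis
  set α : ℝ := 2 * Real.pi * (k / N)
  have hα0 : 0 ≤ α := by positivity
  have hα1 : α ≤ 2 * Real.pi := by
    have : (k:ℝ) / N ≤ 1 := by rw [div_le_one hN']; linarith
    simp only [α]
    nlinarith [Real.pi_pos]
  have hstep : step u N = ((u / N : ℝ):ℂ) + ((2 * Real.pi / N : ℝ) : ℂ) * I := by
    rw [← step_re, ← step_im]; exact (re_add_im _).symm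
  have da : ‖a - α * I‖ ≤ (1 + ‖xi u‖) / N := by
    have e : a - α * I = ((-σ + k * (u / N) : ℝ) : ℂ) := by
      simp only [a, α, hstep]; push_cast; ring
    rw [e, Complex.norm_real, Real.norm_eq_abs, abs_le]
    have : u / N ≤ (1 + ‖xi u‖) / N := by gcongr; linarith [norm_nonneg (xi u)]
    constructor <;> linarith
  have db : ‖b - -(α * I)‖ ≤ (1 + ‖xi u‖) / N := by
    have e : b - -(α * I) = ((σ - k * (u / N) : ℝ) : ℂ) - step u N := by
      have : ((k:ℂ) * step u N) = ((k * (u / N) : ℝ):ℂ) + α * I := by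
        simp only [α, hstep]; push_cast; ring
      simp only [b]; push_cast
      rw [add_mul, this]; push_cast; ring
    rw [e]
    refine (norm_sub_le _ _).trans ?_
    rw [add_div, step, norm_div, Complex.norm_natCast, Complex.norm_real, Real.norm_eq_abs]
    gcongr
    rw [abs_le]
    have : u / N ≤ 1 / N := by gcongr
    constructor <;> linarith
  have La := hli a (α * I) ha (by simp)
  have Lb := hli b (-(α * I)) hb (by simp)
  have hsum := li_I_add_li_neg_I hα0 hα1
  set δ : ℝ := 2 * K * √((1 + ‖xi u‖) / N)
  have hδ0 : 0 ≤ δ := by positivity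
  have hab : ‖li a + li b - ((Real.pi ^ 2 / 3 - Real.pi * α + α ^ 2 / 2 : ℝ) : ℂ)‖ ≤ δ := by
    rw [← hsum, show li a + li b - (li (α * I) + li (-(α * I))) =
      (li a - li (α * I)) + (li b - li (-(α * I))) by ring]
    refine (norm_add_le _ _).trans ?_
    have e1 : ‖li a - li (α * I)‖ ≤ K * √((1 + ‖xi u‖) / N) := La.trans (by gcongr)
    have e2 : ‖li b - li (-(α * I))‖ ≤ K * √((1 + ‖xi u‖) / N) := Lb.trans (by gcongr)
    simp only [δ]; linarith
  have hre := abs_le.mp ((abs_re_le_norm _).trans hab)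
  have him := abs_le.mp ((abs_im_le_norm _).trans hab)
  rw [sub_re, ofReal_re, add_re] at hre
  rw [sub_im, ofReal_im, add_im] at him
  have hrate : u * (Real.pi ^ 2 / 3 - Real.pi * α + α ^ 2 / 2) - 8 * δ ≤
      rate u (li a) + rate u (li b) := by
    rw [rate, rate]
    have hpi4 := Real.pi_lt_d2
    have hpi0 := Real.pi_pos
    nlinarith [mul_le_mul_of_nonneg_left him.1 hpi0.le, mul_le_mul_of_nonneg_left hre.1 hu.le]
  have hδN : N * (1 / xiSq u * (8 * δ)) = B * √N := by
    have : √((1 + ‖xi u‖) / N) = √(1 + ‖xi u‖) / √N := Real.sqrt_div (by positivity) _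
    have hs : (N:ℝ) = √N * √N := (Real.mul_self_sqrt hN'.le).symm
    have hs0 : √(N:ℝ) ≠ 0 := (Real.sqrt_pos.mpr hN').ne'
    simp only [δ, B, this]
    field_simp
    rw [sq, ← hs]
    ring
  -- real estimates
  have hr1 : rate u (li (-u - (u + σ))) = u * (li ((-u - (u + σ) : ℝ):ℂ)).re := by
    have := li_ofReal_im (-u - (u + σ))
    push_cast at this ⊢
    rw [rate, this]; ring
  have hr2 : rate u (li (-σ)) = u * (li ((-σ : ℝ):ℂ)).re := by
    have := li_ofReal_im (-σ)
    push_cast at this ⊢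
    rw [rate, this]; ring
  have hr3 : rate u (u + σ) = u * (u + σ) := by simp [rate]
  have m1 := li_ofReal_re_mono (x := -u - (u + σ)) (y := -u - u) (by linarith) (by linarith)
  have m2 := li_ofReal_re_le (x := -σ) (by linarith)
  have m3 := real_rate_nonpos hu hu3 hu.le le_rfl
  have m4 : (li ((u - u : ℝ) : ℂ)).re = Real.pi ^ 2 / 6 := by
    have := li_I_add_li_neg_I le_rfl (by positivity : (0:ℝ) ≤ 2 * Real.pi)
    simp only [ofReal_zero, zero_mul, neg_zero] at this
    have := congrArg re this
    rw [add_re, ofReal_re] at this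
    rw [sub_self, ofReal_zero]
    linarith
  rw [m4] at m3
  set κ : ℝ := k / N
  have hκ0 : 0 ≤ κ := by positivity
  have hκ1 : κ ≤ 1 := by rw [div_le_one hN']; linarith
  have hkκ : (k:ℝ) = N * κ := by simp only [κ]; field_simp
  have hz1 : u * κ ≤ σ := by
    calc u * κ = k * (u / N) := by simp only [κ]; ring
      _ ≤ σ := hk1
  have hz2 : σ ≤ u * κ + u / N := by
    calc σ ≤ (k + 1) * (u / N) := hk2
      _ = _ := by simp only [κ]; ring
  have hmain : u * (u * (u + σ)) + xiSq u * (κ * σ - κ ^ 2 / 2 * u) +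
      u * (li ((-u - (u + σ) : ℝ):ℂ)).re + u * (li ((-σ : ℝ):ℂ)).re -
      u * (Real.pi ^ 2 / 3 - Real.pi * α + α ^ 2 / 2) ≤
      4 * Real.pi ^ 2 * σ + xiSq u * (u / N) := by
    have hα : Real.pi ^ 2 / 3 - Real.pi * α + α ^ 2 / 2 =
      Real.pi ^ 2 / 3 - 2 * Real.pi ^ 2 * (κ * (1 - κ)) := by
      simp only [α]; ring
    rw [hα]
    exact rate_right_le hu hu1 h0 hκ0 hκ1 hz1 hz2 (m1.trans (by linarith)) m2
  have hNR : 0 ≤ N / xiSq u := by positivity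
  have hfin := mul_le_mul_of_nonneg_left hmain hNR
  have hfin2 := mul_le_mul_of_nonneg_left hrate hNR
  have t1 : N / xiSq u * (xiSq u * (u / N)) = u := by field_simp
  have t2 : N / xiSq u * (xiSq u * (κ * σ - κ ^ 2 / 2 * u)) = k * σ - k ^ 2 / 2 * (u / N) := by
    rw [hkκ]; field_simp
  have t3 : N / xiSq u * (8 * δ) = B * √N := by rw [← hδN]; ring
  have t4 : (1:ℝ) ≤ √N := by rw [Real.one_le_sqrt]; exact hN1
  rw [hr1] at A
  rw [hr2] at A3
  rw [hr3]
  have t5 : (4 * C + 3) * 1 ≤ (4 * C + 3) * √N := by gcongr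
  simp only [mul_sub, mul_add, t1, t3] at hfin hfin2
  simp only [mul_sub] at t2
  simp only [mul_add, add_mul] at *
  linarith [A.1, A.2, A2.1, A2.2, A3.1, A3.2, A4.1, A4.2]

lemma half_le_norm_one_add_exp {u : ℝ} (hu : 0 < u) (hu1 : u ≤ 1) (x : ℝ) :
    1 / 2 ≤ ‖1 + exp (x * (2 * Real.pi + u * I))‖ := by
  have hre : ((x:ℂ) * (2 * Real.pi + u * I)).re = x * (2 * Real.pi) := by
    simp [-ofReal_mul]
  have him : ((x:ℂ) * (2 * Real.pi + u * I)).im = x * u := by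
    simp
  have hpi := Real.pi_gt_three
  have key : 1 < |x| → 1 / 2 ≤ ‖1 + exp (x * (2 * Real.pi + u * I))‖ := fun hx => by
    have hn : ‖exp (x * (2 * Real.pi + u * I))‖ = Real.exp (x * (2 * Real.pi)) := by
      rw [Complex.norm_exp, hre]
    rcases le_or_gt 0 x with h0 | h0
    · rw [abs_of_nonneg h0] at hx
      have h1 := Real.add_one_le_exp (x * (2 * Real.pi))
      have h2 := norm_sub_le (1 + exp (x * (2 * Real.pi + u * I))) 1
      rw [add_sub_cancel_left, hn, norm_one] at h2
      nlinarith
    · rw [abs_of_neg h0] at hx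
      have h1 := Real.add_one_le_exp (-(x * (2 * Real.pi)))
      have h2 := norm_sub_le (1 + exp (x * (2 * Real.pi + u * I))) (exp (x * (2 * Real.pi + u * I)))
      rw [add_sub_cancel_right, hn, norm_one] at h2
      have h3 : Real.exp (x * (2 * Real.pi)) ≤ 1 / 2 := by
        rw [Real.exp_neg] at h1
        have h4 : 2 ≤ (Real.exp (x * (2 * Real.pi)))⁻¹ := by nlinarith
        rw [le_inv_comm₀ two_pos (Real.exp_pos _)] at h4
        linarith
      linarith
  by_cases hx : |x| ≤ 1
  · have h1 : |x * u| ≤ Real.pi / 2 := by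
      rw [abs_mul, abs_of_pos hu]
      nlinarith [abs_nonneg x]
    have h2 : 0 ≤ (exp (x * (2 * Real.pi + u * I))).re := by
      rw [Complex.exp_re, him]
      have := Real.cos_nonneg_of_mem_Icc (x := x * u) ⟨by linarith [(abs_le.mp h1).1], (abs_le.mp h1).2⟩
      positivity
    have h3 := (le_abs_self _).trans (abs_re_le_norm (1 + exp (x * (2 * Real.pi + u * I))))
    rw [add_re, one_re] at h3
    linarith
  · exact key (not_le.mp hx)

lemma half_norm_le_norm_one_add_exp {u : ℝ} (hu : 0 < u) (hu1 : u ≤ 1) (x : ℝ) :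
    Real.exp (x * (2 * Real.pi)) / 2 ≤ ‖1 + exp (x * (2 * Real.pi + u * I))‖ := by
  have h := half_le_norm_one_add_exp hu hu1 (-x)
  have e : 1 + exp (x * (2 * Real.pi + u * I)) =
      exp (x * (2 * Real.pi + u * I)) * (1 + exp ((-x : ℝ) * (2 * Real.pi + u * I))) := by
    rw [mul_add (exp _), ← Complex.exp_add, mul_one, ofReal_neg, ← add_mul, add_neg_cancel, zero_mul,
      Complex.exp_zero, add_comm]
  have hre : ((x:ℂ) * (2 * Real.pi + u * I)).re = x * (2 * Real.pi) := by
    simp [-ofReal_mul]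
  rw [e, norm_mul, Complex.norm_exp, hre, div_eq_mul_one_div]
  gcongr

lemma efun_eq (u : ℝ) (N : ℕ) (s : ℝ) :
    efun u N s = exp ((2 * Real.pi * N / xiSq u * s : ℝ) * (2 * Real.pi + u * I)) := by
  rw [efun, div_xi_eq]
  congr 1
  push_cast
  linear_combination (-(4:ℂ) * Real.pi ^ 2 * N / (xiSq u : ℝ) * s) * I_sq

lemma efun_xi_add {u : ℝ} {N : ℕ} (z : ℂ) : efun u N (xi u + z) = efun u N z := by
  have hx := xi_ne_zero u
  rw [efun, efun, show 2 * Real.pi * I * (N / xi u * (xi u + z)) =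
    2 * Real.pi * I * (N / xi u * z) + N * (2 * Real.pi * I) by field_simp; ring,
    Complex.exp_add, Complex.exp_nat_mul_two_pi_mul_I, mul_one]

lemma norm_kfun_bottom_le {u : ℝ} (hu : 0 < u) (hu1 : u < 1)
    (hu3 : Real.exp u + Real.exp (-u) < 3) :
    ∃ C : ℝ, 0 < C ∧ ∀ N : ℕ, N ≠ 0 → ∀ s : ℝ, 0 ≤ s → s ≤ 2 * u →
      ‖kfun u N s‖ ≤ 2 * Real.exp (C * √N + N / xiSq u * (4 * Real.pi ^ 2 * u)) ∧
      ‖kfun u N (s + 2 * Real.pi * I)‖ ≤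
        2 * Real.exp (C * √N + N / xiSq u * (4 * Real.pi ^ 2 * u)) := by
  obtain ⟨C₁, hC₁, h₁⟩ := exists_norm_gfun_le_left hu hu3
  obtain ⟨C₂, hC₂, h₂⟩ := exists_norm_gfun_le_right hu hu1 hu3
  have hR := xiSq_pos u
  refine ⟨C₁ + C₂, by positivity, fun N hN s h0 h1 => ?_⟩
  have hN' : (0:ℝ) < N := by positivity
  have hN1 : (1:ℝ) ≤ √N := by
    rw [Real.one_le_sqrt]; exact_mod_cast Nat.one_le_iff_ne_zero.mpr hN
  have hC : C₁ ≤ (C₁ + C₂) * √N := by nlinarith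
  have hC' : C₂ * √N ≤ (C₁ + C₂) * √N := by gcongr; linarith
  have hM : 0 ≤ N / xiSq u * (4 * Real.pi ^ 2 * u) := by positivity
  have htop : (s:ℂ) + 2 * Real.pi * I = xi u + (s - u : ℝ) := by
    rw [xi]; push_cast; ring
  have hl : ‖exp (N / xi u * (u * (2 * Real.pi * I)))‖ =
      Real.exp (N / xiSq u * (4 * Real.pi ^ 2 * u)) := by
    rw [Complex.norm_exp, div_xi_mul_re, rate]
    congr 2
    have e : (u:ℂ) * (2 * Real.pi * I) = ((u * (2 * Real.pi) : ℝ):ℂ) * I := by push_cast; ring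
    rw [e, re_ofReal_mul, im_ofReal_mul, I_re, I_im]
    ring
  have d1 : 1 / 2 ≤ ‖1 + efun u N s‖ := by
    rw [efun_eq]; exact half_le_norm_one_add_exp hu hu1.le _
  have d2 : 1 / 2 ≤ ‖1 + efun u N ((s - u : ℝ):ℂ)‖ := by
    rw [efun_eq]; exact half_le_norm_one_add_exp hu hu1.le _
  have d3 : Real.exp (N / xiSq u * (4 * Real.pi ^ 2 * (s - u))) / 2 ≤
      ‖1 + efun u N ((s - u : ℝ):ℂ)‖ := by
    have := half_norm_le_norm_one_add_exp hu hu1.le (2 * Real.pi * N / xiSq u * (s - u))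
    rw [efun_eq]
    convert this using 3
    ring
  rw [kfun, kfun, gfun_add_two_pi, htop, efun_xi_add, norm_div, norm_div, norm_mul, hl,
    div_le_iff₀ (by linarith), div_le_iff₀ (by linarith)]
  rw [Real.exp_add]
  set X := Real.exp (N / xiSq u * (4 * Real.pi ^ 2 * u))
  have hX : 1 ≤ X := Real.one_le_exp hM
  rcases le_total s u with hs | hs
  · have g := (h₁ N hN s h0 hs).trans (Real.exp_le_exp.mpr hC)
    set Y := Real.exp ((C₁ + C₂) * √N)
    have hY : 0 < Y := Real.exp_pos _
    have hXY : Y ≤ Y * X := le_mul_of_one_le_right hY.le hX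
    have p1 := mul_le_mul_of_nonneg_left d1 (by positivity : 0 ≤ 2 * (Y * X))
    have p2 := mul_le_mul_of_nonneg_left d2 (by positivity : 0 ≤ 2 * (Y * X))
    have p3 := mul_le_mul_of_nonneg_left g (by positivity : 0 ≤ X)
    constructor <;> linarith
  · have g := h₂ N hN (s - u) (by linarith) (by linarith)
    rw [show (u:ℂ) + (s - u : ℝ) = s by push_cast; ring, Real.exp_add] at g
    have g1 := g.trans (mul_le_mul_of_nonneg_right (Real.exp_le_exp.mpr hC') (Real.exp_pos _).le)
    have hZX : Real.exp (N / xiSq u * (4 * Real.pi ^ 2 * (s - u))) ≤ X := by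
      simp only [X]
      gcongr
      linarith
    set Z := Real.exp (N / xiSq u * (4 * Real.pi ^ 2 * (s - u)))
    set Y := Real.exp ((C₁ + C₂) * √N)
    have hY : 0 < Y := Real.exp_pos _
    have p0 := mul_le_mul_of_nonneg_left hZX hY.le
    have p1 := mul_le_mul_of_nonneg_left d1 (by positivity : 0 ≤ 2 * (Y * X))
    have p2 := mul_le_mul_of_nonneg_left d3 (by positivity : 0 ≤ 2 * (Y * X))
    have p3 := mul_le_mul_of_nonneg_left g1 (by positivity : 0 ≤ X)
    constructor <;> linarith

lemma norm_integral_kfun_horizontal_le {u : ℝ} (hu : 0 < u) (hu1 : u < 1)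
    (hu3 : Real.exp u + Real.exp (-u) < 3) :
    ∃ C : ℝ, 0 < C ∧ ∀ N : ℕ, N ≠ 0 →
      ‖∫ s in (0:ℝ)..(2 * u), kfun u N s‖ ≤
        4 * Real.exp (C * √N + N / xiSq u * (4 * Real.pi ^ 2 * u)) ∧
      ‖∫ s in (0:ℝ)..(2 * u), kfun u N (s + 2 * Real.pi * I)‖ ≤
        4 * Real.exp (C * √N + N / xiSq u * (4 * Real.pi ^ 2 * u)) := by
  obtain ⟨C, hC, h⟩ := norm_kfun_bottom_le hu hu1 hu3
  refine ⟨C, hC, fun N hN => ?_⟩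
  set X := Real.exp (C * √N + N / xiSq u * (4 * Real.pi ^ 2 * u))
  have hX : 0 < X := Real.exp_pos _
  have hle : 2 * X * |2 * u - 0| ≤ 4 * X := by
    rw [sub_zero, abs_of_pos (by positivity)]; nlinarith
  constructor
  · refine (intervalIntegral.norm_integral_le_of_norm_le_const (C := 2 * X) fun s hs => ?_).trans hle
    rw [Set.uIoc_of_le (by positivity)] at hs
    exact (h N hN s hs.1.le hs.2).1
  · refine (intervalIntegral.norm_integral_le_of_norm_le_const (C := 2 * X) fun s hs => ?_).trans hle
    rw [Set.uIoc_of_le (by positivity)] at hs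
    exact (h N hN s hs.1.le hs.2).2

/-- The height function `t ↦ u t - 2 Im Li₂(exp (-u + i t))`, whose maximum gives the growth rate. -/
noncomputable def hfun (u t : ℝ) : ℝ := u * t - 2 * (li (-u + t * I)).im

/-- The angle `arccos (cosh u - 1/2)`. -/
noncomputable def theta (u : ℝ) : ℝ := Real.arccos (Real.cosh u - 1 / 2)

/-- The point where `hfun u` is maximal. -/
noncomputable def tsad (u : ℝ) : ℝ := 2 * Real.pi - theta u

lemma hasDerivAt_li_vertical {v : ℝ} (hv : 0 < v) (t : ℝ) :
    HasDerivAt (fun t : ℝ => li (-v + t * I)) (-log (1 - exp (-v + t * I)) * I) t := by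
  have h1 : HasDerivAt (fun t : ℝ => (-v + t * I : ℂ)) I t := by
    simpa using ((hasDerivAt_id t).ofReal_comp.mul_const I).const_add (-v : ℂ)
  have h2 := hasDerivAt_li (v := -v + t * I) (by simpa using hv)
  exact h2.comp t h1

lemma hasDerivAt_hfun {u : ℝ} (hu : 0 < u) (t : ℝ) :
    HasDerivAt (hfun u) (Real.log (2 * Real.cosh u - 2 * Real.cos t)) t := by
  have h1 := (hasDerivAt_li_vertical hu t)
  have h2 : HasDerivAt (fun t : ℝ => (li (-u + t * I)).im) (-log (1 - exp (-u + t * I)) * I).im t :=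
    imCLM.hasFDerivAt.comp_hasDerivAt t h1
  have h3 := ((hasDerivAt_id t).const_mul u).sub (h2.const_mul 2)
  refine h3.congr_deriv ?_
  symm
  have hlt : ‖exp (-u + t * I : ℂ)‖ < 1 := by
    rw [Complex.norm_exp]; simpa using hu
  have hne : 1 - exp (-u + t * I : ℂ) ≠ 0 := fun h => by
    rw [← sub_eq_zero.mp h] at hlt; simp at hlt
  have hsq : ‖1 - exp (-u + t * I : ℂ)‖ ^ 2 = 1 - 2 * Real.exp (-u) * Real.cos t + Real.exp (-u) ^ 2 := by
    rw [← normSq_eq_norm_sq, normSq_apply]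
    simp only [sub_re, sub_im, one_re, one_im, exp_re, exp_im]
    have e1 : (-(u:ℂ) + t * I).re = -u := by simp
    have e2 : (-(u:ℂ) + t * I).im = t := by simp
    rw [e1, e2]
    linear_combination Real.exp (-u) ^ 2 * Real.sin_sq_add_cos_sq t
  have e1 : 2 * Real.cosh u - 2 * Real.cos t = Real.exp u * ‖1 - exp (-u + t * I : ℂ)‖ ^ 2 := by
    rw [hsq, Real.cosh_eq]
    have : Real.exp u * Real.exp (-u) = 1 := by rw [← Real.exp_add]; simp
    linear_combination (2 * Real.cos t - Real.exp (-u)) * this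
  rw [e1, Real.log_mul (Real.exp_ne_zero _) (by simpa using hne), Real.log_exp, Real.log_pow]
  simp only [mul_im, neg_re, neg_im, I_re, I_im, log_re]
  push_cast
  ring

lemma two_cosh_sub_pos {u : ℝ} (hu : 0 < u) (t : ℝ) : 0 < 2 * Real.cosh u - 2 * Real.cos t := by
  have := Real.one_lt_cosh.mpr hu.ne'
  linarith [Real.cos_le_one t]

lemma cos_theta {u : ℝ} (hu3 : Real.exp u + Real.exp (-u) < 3) :
    Real.cos (theta u) = Real.cosh u - 1 / 2 := by
  rw [theta, Real.cos_arccos]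
  · linarith [Real.one_le_cosh u]
  · rw [Real.cosh_eq]; linarith

lemma theta_pos {u : ℝ} (hu3 : Real.exp u + Real.exp (-u) < 3) : 0 < theta u := by
  rw [theta, Real.arccos_pos, Real.cosh_eq]; linarith

lemma theta_lt {u : ℝ} (hu : 0 < u) : theta u < Real.pi / 3 := by
  have := Real.one_lt_cosh.mpr hu.ne'
  by_contra! h
  have h1 := Real.cos_le_cos_of_nonneg_of_le_pi (by positivity : 0 ≤ Real.pi / 3)
    (Real.arccos_le_pi _) h
  rw [Real.cos_pi_div_three] at h1
  have hc : Real.cos (Real.arccos (Real.cosh u - 1 / 2)) ≤ 1 / 2 := h1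
  rcases le_total (Real.cosh u - 1 / 2) 1 with h2 | h2
  · rw [Real.cos_arccos (by linarith) h2] at hc; linarith
  · rw [Real.arccos_of_one_le h2, Real.cos_zero] at hc; norm_num at hc

lemma cos_tsad {u : ℝ} (hu3 : Real.exp u + Real.exp (-u) < 3) :
    Real.cos (tsad u) = Real.cosh u - 1 / 2 := by
  rw [tsad, Real.cos_two_pi_sub, cos_theta hu3]

lemma hfun_zero (u : ℝ) : hfun u 0 = 0 := by
  have := li_ofReal_im (-u)
  push_cast at this
  simp [hfun, this]

lemma hfun_two_pi (u : ℝ) : hfun u (2 * Real.pi) = 2 * Real.pi * u := by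
  have := li_ofReal_im (-u)
  push_cast at this
  have h2 := li_add_two_pi (-u)
  rw [hfun]
  push_cast
  rw [h2, this]
  ring

lemma continuous_hfun {u : ℝ} (hu : 0 < u) : Continuous (hfun u) :=
  continuous_iff_continuousAt.mpr fun t => (hasDerivAt_hfun hu t).continuousAt

lemma tsad_mem {u : ℝ} (hu : 0 < u) (hu3 : Real.exp u + Real.exp (-u) < 3) :
    tsad u ∈ Set.Ioo 0 (2 * Real.pi) := by
  have := theta_pos hu3
  have := theta_lt hu
  have := Real.pi_pos
  constructor <;> rw [tsad] <;> linarith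

lemma hfun_two_pi_lt {u : ℝ} (hu : 0 < u) (hu3 : Real.exp u + Real.exp (-u) < 3) {t : ℝ}
    (h0 : tsad u < t) (h1 : t ≤ 2 * Real.pi) : hfun u t < hfun u (tsad u) := by
  have ht := tsad_mem hu hu3
  have hlt := theta_lt hu
  have hpi := Real.pi_pos
  have : StrictAntiOn (hfun u) (Set.Icc (tsad u) (2 * Real.pi)) := by
    refine strictAntiOn_of_deriv_neg (convex_Icc _ _) (continuous_hfun hu).continuousOn fun x hx => ?_
    rw [interior_Icc] at hx
    rw [(hasDerivAt_hfun hu x).deriv]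
    refine Real.log_neg (two_cosh_sub_pos hu x) ?_
    have h : Real.cos (2 * Real.pi - x) > Real.cos (theta u) := by
      refine Real.cos_lt_cos_of_nonneg_of_le_pi ?_ ?_ ?_
      · linarith [hx.2]
      · linarith
      · have := hx.1; rw [tsad] at this; linarith
    rw [Real.cos_two_pi_sub, cos_theta hu3] at h
    linarith
  exact this (Set.left_mem_Icc.mpr ht.2.le) ⟨h0.le, h1⟩ h0

lemma hfun_lt {u : ℝ} (hu : 0 < u) (hu3 : Real.exp u + Real.exp (-u) < 3) {t : ℝ}
    (h0 : 0 ≤ t) (h1 : t ≤ 2 * Real.pi) (hne : t ≠ tsad u) : hfun u t < hfun u (tsad u) := by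
  have ht := tsad_mem hu hu3
  have hlt := theta_lt hu
  have hth := theta_pos hu3
  have hpi := Real.pi_pos
  rcases hne.lt_or_gt with h | h
  swap
  · exact hfun_two_pi_lt hu hu3 h h1
  have hcos : ∀ x, 0 ≤ x → x ≤ Real.pi → theta u < x → Real.cos x < Real.cosh u - 1 / 2 := by
    intro x _ h1 h2
    rw [← cos_theta hu3]
    exact Real.cos_lt_cos_of_nonneg_of_le_pi hth.le h1 h2
  rcases le_total t (theta u) with h2 | h2
  · have ha : AntitoneOn (hfun u) (Set.Icc 0 (theta u)) := by
      refine antitoneOn_of_deriv_nonpos (convex_Icc _ _) (continuous_hfun hu).continuousOn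
        (fun x _ => (hasDerivAt_hfun hu x).differentiableAt.differentiableWithinAt) fun x hx => ?_
      rw [interior_Icc] at hx
      rw [(hasDerivAt_hfun hu x).deriv]
      refine Real.log_nonpos (two_cosh_sub_pos hu x).le ?_
      have h : Real.cos x > Real.cos (theta u) := by
        refine Real.cos_lt_cos_of_nonneg_of_le_pi hx.1.le ?_ hx.2
        linarith
      rw [cos_theta hu3] at h
      linarith
    have h3 := ha ⟨le_rfl, hth.le⟩ ⟨h0, h2⟩ h0
    have h4 := hfun_two_pi_lt hu hu3 ht.2 le_rfl
    rw [hfun_zero] at h3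
    rw [hfun_two_pi] at h4
    have : 0 < 2 * Real.pi * u := by positivity
    linarith
  · have hm : StrictMonoOn (hfun u) (Set.Icc (theta u) (tsad u)) := by
      refine strictMonoOn_of_deriv_pos (convex_Icc _ _) (continuous_hfun hu).continuousOn
        fun x hx => ?_
      rw [interior_Icc] at hx
      rw [(hasDerivAt_hfun hu x).deriv]
      refine Real.log_pos ?_
      have h : Real.cos x < Real.cosh u - 1 / 2 := by
        rcases le_total x Real.pi with hx2 | hx2
        · exact hcos x (by linarith [hx.1]) hx2 hx.1
        · have := hx.2
          rw [tsad] at this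
          rw [← Real.cos_two_pi_sub]
          exact hcos _ (by linarith) (by linarith) (by linarith)
      linarith
    exact hm ⟨h2, h.le⟩ ⟨by rw [tsad]; linarith, le_rfl⟩ h

lemma tendsto_hfun_div_sq {u : ℝ} (hu : 0 < u) (hu3 : Real.exp u + Real.exp (-u) < 3) :
    Tendsto (fun t => (hfun u t - hfun u (tsad u)) / (t - tsad u) ^ 2) (𝓝[≠] tsad u)
      (𝓝 (-Real.sin (theta u))) := by
  have h1 : Real.cosh u * 2 - 2 * Real.cos (tsad u) = 1 := by rw [cos_tsad hu3]; ring
  have hd : ∀ t, HasDerivAt (fun t => (t - tsad u) ^ 2) (2 * (t - tsad u)) t := fun t => by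
    have := ((hasDerivAt_id t).sub_const (tsad u)).pow 2
    refine this.congr_deriv ?_
    simp
  have hdd : HasDerivAt (fun t => Real.log (2 * Real.cosh u - 2 * Real.cos t))
      (-(2 * Real.sin (theta u))) (tsad u) := by
    have a1 := ((Real.hasDerivAt_cos (tsad u)).const_mul 2).const_sub (2 * Real.cosh u)
    have a2 := a1.log (two_cosh_sub_pos hu _).ne'
    convert a2 using 1
    rw [mul_comm 2 (Real.cosh u), h1, tsad, Real.sin_two_pi_sub]
    ring
  have hz : Real.log (2 * Real.cosh u - 2 * Real.cos (tsad u)) = 0 := by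
    rw [mul_comm 2 (Real.cosh u), h1, Real.log_one]
  refine HasDerivAt.lhopital_zero_nhdsNE (f := fun t => hfun u t - hfun u (tsad u))
    (f' := fun t => Real.log (2 * Real.cosh u - 2 * Real.cos t)) (g' := fun t => 2 * (t - tsad u))
    (Eventually.of_forall fun t => (hasDerivAt_hfun hu t).sub_const _)
    (Eventually.of_forall fun t => hd t) ?_ ?_ ?_ ?_
  · filter_upwards [self_mem_nhdsWithin] with t ht
    exact mul_ne_zero two_ne_zero (sub_ne_zero.mpr ht)
  · have := ((continuous_hfun hu).sub (continuous_const (y := hfun u (tsad u)))).tendsto (tsad u)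
    rw [Pi.sub_apply, sub_self] at this
    exact this.mono_left nhdsWithin_le_nhds
  · have := (hd (tsad u)).continuousAt.tendsto
    simp only [sub_self, ne_eq, OfNat.ofNat_ne_zero, not_false_eq_true, zero_pow] at this
    exact this.mono_left nhdsWithin_le_nhds
  · have := hasDerivAt_iff_tendsto_slope.mp hdd
    have h2 := this.div_const 2
    rw [show -(2 * Real.sin (theta u)) / 2 = -Real.sin (theta u) by ring] at h2
    refine h2.congr fun t => ?_
    rw [slope_def_field, hz, sub_zero, div_div, mul_comm 2 (t - _)]

lemma exists_hfun_le {u : ℝ} (hu : 0 < u) (hu3 : Real.exp u + Real.exp (-u) < 3) :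
    ∃ a : ℝ, 0 < a ∧ ∀ t, 0 ≤ t → t ≤ 2 * Real.pi →
      hfun u t - hfun u (tsad u) ≤ -a * (t - tsad u) ^ 2 := by
  have hlim := tendsto_hfun_div_sq hu hu3
  set q := Function.update (fun t => (hfun u t - hfun u (tsad u)) / (t - tsad u) ^ 2) (tsad u)
    (-Real.sin (theta u)) with hq
  have ht := tsad_mem hu hu3
  have hth := theta_pos hu3
  have hlt := theta_lt hu
  have hpi := Real.pi_pos
  have hc : Continuous q := by
    refine continuous_iff_continuousAt.mpr fun t => ?_
    rcases eq_or_ne t (tsad u) with rfl | hne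
    · exact continuousAt_update_same.mpr hlim
    · rw [continuousAt_update_of_ne hne]
      exact ((continuous_hfun hu).continuousAt.sub continuousAt_const).div (by fun_prop)
        (pow_ne_zero _ (sub_ne_zero.mpr hne))
  obtain ⟨t₁, ht₁, hmax⟩ := (isCompact_Icc (a := (0:ℝ)) (b := 2 * Real.pi)).exists_isMaxOn
    ⟨_, ht.1.le, ht.2.le⟩ hc.continuousOn
  have hneg : q t₁ < 0 := by
    rcases eq_or_ne t₁ (tsad u) with h | hne
    · rw [h, hq, Function.update_self]
      linarith [Real.sin_pos_of_pos_of_lt_pi hth (by linarith)]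
    · rw [hq, Function.update_of_ne hne]
      exact div_neg_of_neg_of_pos (sub_neg.mpr (hfun_lt hu hu3 ht₁.1 ht₁.2 hne))
        (by have := sub_ne_zero.mpr hne; positivity)
  refine ⟨-q t₁, by linarith, fun t h0 h1 => ?_⟩
  rcases eq_or_ne t (tsad u) with rfl | hne
  · simp
  · have h := hmax ⟨h0, h1⟩
    simp only [Set.mem_ofPred_eq] at h
    rw [hq, Function.update_of_ne hne, ← hq] at h
    have hp : 0 < (t - tsad u) ^ 2 := by
      have := sub_ne_zero.mpr hne
      positivity
    rw [div_le_iff₀ hp] at h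
    linarith

/-- Laplace's method with complex scale `μ`, slowly varying amplitude `g N` and interior maximum. -/
lemma tendsto_sqrt_mul_integral_laplace {a b t₀ s c M V : ℝ} {μ g₀ : ℂ} {h : ℝ → ℝ}
    {g : ℕ → ℝ → ℂ} (ha : a < t₀) (hb : t₀ < b) (hc : 0 < c) (hμ : 0 < μ.re)
    (hcont : Continuous h) (hV : V = h t₀)
    (hle : ∀ t, a ≤ t → t ≤ b → h t - V ≤ -c * (t - t₀) ^ 2)
    (hlim : Tendsto (fun t => (h t - V) / (t - t₀) ^ 2) (𝓝[≠] t₀) (𝓝 (-s)))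
    (hg : ∀ N, N ≠ 0 → ContinuousOn (g N) (Set.Icc a b))
    (hgM : ∀ N, N ≠ 0 → ∀ t, a ≤ t → t ≤ b → ‖g N t‖ ≤ M)
    (hg₀ : ∀ x : ℝ, Tendsto (fun N : ℕ => g N (t₀ + x / √N)) atTop (𝓝 g₀)) :
    Tendsto (fun N : ℕ => (√N : ℂ) * ∫ t in a..b, exp (N * μ * (h t - V : ℝ)) * g N t) atTop
      (𝓝 (g₀ * ∫ x : ℝ, exp (-(μ * s) * (x:ℂ) ^ 2))) := by
  have hM : 0 ≤ M := (norm_nonneg _).trans (hgM 1 one_ne_zero t₀ ha.le hb.le)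
  set F : ℕ → ℝ → ℂ := fun N => (Set.Ioc a b).indicator
    fun t => exp (N * μ * (h t - V : ℝ)) * g N t with hF
  have hsub : ∀ N : ℕ, N ≠ 0 → (√N : ℂ) * ∫ t in a..b, exp (N * μ * (h t - V : ℝ)) * g N t =
      ∫ x : ℝ, F N (t₀ + x / √N) := by
    intro N hN
    have hN' : 0 < √(N:ℝ) := Real.sqrt_pos.mpr (by positivity)
    rw [Measure.integral_comp_div (fun y => F N (t₀ + y)) (√N),
      integral_add_left_eq_self (F N) t₀, hF, integral_indicator measurableSet_Ioc,
      ← intervalIntegral.integral_of_le (ha.trans hb).le, abs_of_pos hN', real_smul]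
  have hmeas : ∀ N, N ≠ 0 → Measurable (F N) := by
    classical
    intro N hN
    have e : F N = (Set.Ioc a b).piecewise (fun t => exp (N * μ * (h t - V : ℝ)) * g N t)
      (fun _ => 0) := by
      exact (Set.piecewise_eq_indicator).symm
    rw [e]
    refine ContinuousOn.measurable_piecewise ?_ continuousOn_const measurableSet_Ioc
    refine ContinuousOn.mul (Continuous.continuousOn (by fun_prop)) ?_
    exact (hg N hN).mono Set.Ioc_subset_Icc_self
  have hpos : ∀ x : ℝ, Tendsto (fun N : ℕ => t₀ + x / √N) atTop (𝓝 t₀) := by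
    intro x
    have h1 : Tendsto (fun N : ℕ => √(N:ℝ)) atTop atTop :=
      Real.tendsto_sqrt_atTop.comp tendsto_natCast_atTop_atTop
    simpa using (tendsto_const_nhds (x := t₀)).add ((tendsto_const_nhds (x := x)).div_atTop h1)
  have key : Tendsto (fun N : ℕ => ∫ x : ℝ, F N (t₀ + x / √N)) atTop
      (𝓝 (∫ x : ℝ, exp (-(μ * s) * (x:ℂ) ^ 2) * g₀)) := by
    refine tendsto_integral_filter_of_dominated_convergence
      (fun x => M * Real.exp (-(μ.re * c) * x ^ 2)) ?_ ?_ ?_ ?_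
    · filter_upwards [eventually_ne_atTop 0] with N hN
      exact ((hmeas N hN).comp (by fun_prop)).aestronglyMeasurable
    · filter_upwards [eventually_ne_atTop 0] with N hN
      refine Eventually.of_forall fun x => ?_
      have hN' : (0:ℝ) < N := by positivity
      simp only [hF]
      by_cases hx : t₀ + x / √N ∈ Set.Ioc a b
      · rw [Set.indicator_of_mem hx, norm_mul, mul_comm]
        refine mul_le_mul (hgM N hN _ hx.1.le hx.2) ?_ (norm_nonneg _) hM
        rw [Complex.norm_exp, re_mul_ofReal, ← ofReal_natCast, re_ofReal_mul, Real.exp_le_exp]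
        have h1 := hle _ hx.1.le hx.2
        rw [add_sub_cancel_left, div_pow, Real.sq_sqrt hN'.le] at h1
        calc N * μ.re * (h (t₀ + x / √N) - V) ≤ N * μ.re * (-c * (x ^ 2 / N)) := by gcongr
          _ = _ := by field_simp
      · rw [Set.indicator_of_notMem hx, norm_zero]
        positivity
    · exact (integrable_exp_neg_mul_sq (mul_pos hμ hc)).const_mul M
    · refine Eventually.of_forall fun x => ?_
      have hin : ∀ᶠ N : ℕ in atTop, t₀ + x / √N ∈ Set.Ioc a b :=
        (hpos x).eventually_mem (Filter.mem_of_superset (Ioo_mem_nhds ha hb) Set.Ioo_subset_Ioc_self)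
      have hexp : Tendsto (fun N : ℕ => N * (h (t₀ + x / √N) - V)) atTop (𝓝 (-s * x ^ 2)) := by
        rcases eq_or_ne x 0 with rfl | hx
        · simp [hV]
        · have h1 : Tendsto (fun N : ℕ => t₀ + x / √N) atTop (𝓝[≠] t₀) := by
            refine tendsto_nhdsWithin_iff.mpr ⟨hpos x, ?_⟩
            filter_upwards [eventually_ne_atTop 0] with N hN
            have : 0 < √(N:ℝ) := Real.sqrt_pos.mpr (by positivity)
            simp [hx, this.ne']
          refine ((hlim.comp h1).mul_const (x ^ 2)).congr' ?_
          filter_upwards [eventually_ne_atTop 0] with N hN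
          have hN' : (0:ℝ) < N := by positivity
          rw [Function.comp_apply, add_sub_cancel_left, div_pow, Real.sq_sqrt hN'.le]
          field_simp
      have h2 : Tendsto (fun N : ℕ => exp (μ * (N * (h (t₀ + x / √N) - V) : ℝ)) *
          g N (t₀ + x / √N)) atTop (𝓝 (exp (μ * (-s * x ^ 2 : ℝ)) * g₀)) :=
        ((Complex.continuous_exp.tendsto _).comp
          (((continuous_ofReal.tendsto _).comp hexp).const_mul μ)).mul (hg₀ x)
      rw [show -(μ * s) * (x:ℂ) ^ 2 = μ * (-s * x ^ 2 : ℝ) by push_cast; ring]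
      refine h2.congr' ?_
      filter_upwards [hin] with N hN
      simp only [hF]
      rw [Set.indicator_of_mem hN]
      congr 2
      push_cast
      ring
  rw [integral_mul_const, mul_comm] at key
  refine key.congr' ?_
  filter_upwards [eventually_ne_atTop 0] with N hN
  exact (hsub N hN).symm

lemma I_div_xi_re (u : ℝ) : (I / xi u).re = 2 * Real.pi / xiSq u := by
  have h := div_xi_mul_re u 1 I
  rw [Nat.cast_one, one_div, inv_mul_eq_div, Nat.cast_one, rate, I_re, I_im] at h
  rw [h]; ring

lemma exists_gfun_left_eq {u : ℝ} (hu : 0 < u) : ∃ C : ℝ, 0 < C ∧ ∀ N : ℕ, N ≠ 0 → ∀ t : ℝ,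
    ∃ e : ℂ, ‖e‖ ≤ C / N ∧
      gfun u N (t * I) = exp (N * (I / xi u) * hfun u t) * exp (-u / 2 + e) := by
  obtain ⟨C, hC, h⟩ := exists_norm_ell_sub_li_le_div hu
  refine ⟨2 * C, by positivity, fun N hN t => ?_⟩
  have huN : 0 < u / N := by positivity
  refine ⟨(ell u N (-u - t * I) - N / xi u * li (-u - t * I)) -
    (ell u N (t * I - u) - N / xi u * li (t * I - u)), ?_, ?_⟩
  · refine (norm_sub_le _ _).trans ?_
    have h1 := h N hN (-u - t * I) (by simp)
    have h2 := h N hN (t * I - u) (by simp)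
    rw [mul_div_assoc]
    linarith
  · rw [gfun, qdk_eq hu hN (Nat.zero_le N) (by simp; linarith), qdk_zero,
      ← Complex.exp_add, ← Complex.exp_add, ← Complex.exp_add]
    congr 1
    have hconj : li (-u - t * I) = starRingEnd ℂ (li (t * I - u)) := by
      rw [← li_conj]; congr 1; simp [sub_eq_add_neg, add_comm]
    have hd : li (-u - t * I) - li (t * I - u) = -(2 * (li (t * I - u)).im : ℝ) * I := by
      rw [hconj]
      apply Complex.ext <;> simp
      ring
    rw [hfun, show (-u + t * I : ℂ) = t * I - u by ring]
    push_cast at hd ⊢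
    linear_combination ((N:ℂ) / xi u) * hd

lemma norm_one_add_exp_ge {u : ℝ} (hu : 0 < u) {x : ℝ} (hx : 0 ≤ x) :
    1 - Real.exp (-u / 4) ≤ ‖1 + exp (x * (-u + 2 * Real.pi * I))‖ := by
  have hre : ((x:ℂ) * (-u + 2 * Real.pi * I)).re = -(x * u) := by
    simp
  have him : ((x:ℂ) * (-u + 2 * Real.pi * I)).im = x * (2 * Real.pi) := by
    simp
  have hpi := Real.pi_gt_three
  rcases le_total x (1 / 4) with h | h
  · have h2 : 0 ≤ (exp (x * (-u + 2 * Real.pi * I))).re := by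
      rw [Complex.exp_re, him]
      have := Real.cos_nonneg_of_mem_Icc (x := x * (2 * Real.pi)) ⟨by nlinarith, by nlinarith⟩
      positivity
    have h3 := (le_abs_self _).trans (abs_re_le_norm (1 + exp (x * (-u + 2 * Real.pi * I))))
    rw [add_re, one_re] at h3
    linarith [Real.exp_pos (-u / 4)]
  · have h2 := norm_sub_le (1 + exp (x * (-u + 2 * Real.pi * I))) (exp (x * (-u + 2 * Real.pi * I)))
    rw [add_sub_cancel_right, norm_one, Complex.norm_exp, hre] at h2
    have h3 : Real.exp (-(x * u)) ≤ Real.exp (-u / 4) := by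
      rw [Real.exp_le_exp]; nlinarith
    linarith

lemma efun_mul_I (u : ℝ) (N : ℕ) (t : ℝ) :
    efun u N (t * I) = exp ((2 * Real.pi * N / xiSq u * t : ℝ) * (-u + 2 * Real.pi * I)) := by
  rw [efun, div_xi_eq]
  congr 1
  push_cast
  linear_combination (2 * Real.pi * N / (xiSq u : ℝ) * t * u - 4 * Real.pi ^ 2 * N / (xiSq u : ℝ) * t * I : ℂ) * I_sq

lemma tendsto_integral_kfun_left {u : ℝ} (hu : 0 < u) (hu3 : Real.exp u + Real.exp (-u) < 3) :
    Tendsto (fun N : ℕ => (√N : ℂ) * exp (-(N * (I / xi u) * hfun u (tsad u))) *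
        ∫ t in (0:ℝ)..(2 * Real.pi), kfun u N (t * I)) atTop
      (𝓝 (exp (-u / 2) * (Real.pi / (I / xi u * Real.sin (theta u))) ^ (1 / 2 : ℂ))) := by
  obtain ⟨C, hC, hgf⟩ := exists_gfun_left_eq hu
  obtain ⟨a, ha, hle⟩ := exists_hfun_le hu hu3
  have ht := tsad_mem hu hu3
  have hR := xiSq_pos u
  have hpi := Real.pi_pos
  have hsin : 0 < Real.sin (theta u) :=
    Real.sin_pos_of_pos_of_lt_pi (theta_pos hu3) (by linarith [theta_lt hu])
  have hμ : 0 < (I / xi u).re := by rw [I_div_xi_re]; positivity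
  set μ := I / xi u
  set d := 1 - Real.exp (-u / 4)
  have hd : 0 < d := by
    have : Real.exp (-u / 4) < 1 := by rw [Real.exp_lt_one_iff]; linarith
    simp only [d]; linarith
  have hden : ∀ N : ℕ, ∀ t : ℝ, 0 ≤ t → d ≤ ‖1 + efun u N (t * I)‖ := fun N t h0 => by
    rw [efun_mul_I]
    exact norm_one_add_exp_ge hu (by positivity)
  have hnorm : ∀ N : ℕ, ∀ t : ℝ, ‖efun u N (t * I)‖ =
      Real.exp (-(2 * Real.pi * u / xiSq u * (N * t))) := fun N t => by
    rw [efun_mul_I, Complex.norm_exp]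
    congr 1
    rw [re_ofReal_mul]
    simp
    ring
  set g : ℕ → ℝ → ℂ := fun N t => kfun u N (t * I) * exp (-(N * μ * hfun u t)) with hgdef
  have hgval : ∀ N : ℕ, N ≠ 0 → ∀ t : ℝ, ∃ e : ℂ, ‖e‖ ≤ C / N ∧
      g N t = exp (-u / 2 + e) / (1 + efun u N (t * I)) := fun N hN t => by
    obtain ⟨e, he, h⟩ := hgf N hN t
    refine ⟨e, he, ?_⟩
    simp only [hgdef, kfun]
    rw [h, div_mul_eq_mul_div, mul_right_comm, ← Complex.exp_add, add_neg_cancel, Complex.exp_zero,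
      one_mul]
  choose! e he heg using hgval
  have hL := tendsto_sqrt_mul_integral_laplace (a := 0) (b := 2 * Real.pi) (t₀ := tsad u)
    (s := Real.sin (theta u)) (c := a) (M := Real.exp (-u / 2 + C) / d) (V := hfun u (tsad u))
    (μ := μ) (g₀ := exp (-u / 2)) (h := hfun u) (g := g) ht.1 ht.2 ha hμ (continuous_hfun hu) rfl hle
    (tendsto_hfun_div_sq hu hu3) ?_ ?_ ?_
  · rw [integral_gaussian_complex (by rw [re_mul_ofReal]; positivity)] at hL
    refine hL.congr fun N => ?_
    rw [mul_assoc, ← intervalIntegral.integral_const_mul (exp _)]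
    congr 2
    funext t
    simp only [hgdef]
    rw [mul_left_comm, ← Complex.exp_add, mul_comm]
    congr 2
    push_cast
    ring
  · intro N hN t h
    refine ContinuousAt.continuousWithinAt ?_
    refine ContinuousAt.mul ?_ ?_
    · have h1 : ContinuousAt (kfun u N) (t * I) :=
        continuousAt_kfun hu hN (by simp) (by simp; positivity) fun h0 => by
          have := hden N t h.1
          rw [h0, norm_zero] at this
          linarith
      exact ContinuousAt.comp (f := fun t : ℝ => (t * I : ℂ)) h1 (by fun_prop)
    · have := continuous_hfun hu
      fun_prop
  · intro N hN t h0 h1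
    rw [heg N hN t, norm_div, Complex.norm_exp]
    have h2 := hden N t h0
    refine div_le_div₀ (Real.exp_pos _).le (Real.exp_le_exp.mpr ?_) hd h2
    have h3 := (abs_re_le_norm (e N t)).trans (he N hN t)
    have h4 : C / N ≤ C := div_le_self hC.le (by exact_mod_cast Nat.one_le_iff_ne_zero.mpr hN)
    have h5 : ((-u / 2 : ℂ)).re = -u / 2 := by
      rw [← ofReal_neg, ← ofReal_ofNat, ← ofReal_div, ofReal_re]
    rw [add_re, h5]
    linarith [le_abs_self (e N t).re]
  · intro x
    have h1 : Tendsto (fun N : ℕ => √(N:ℝ)) atTop atTop :=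
      Real.tendsto_sqrt_atTop.comp tendsto_natCast_atTop_atTop
    have hpos : Tendsto (fun N : ℕ => tsad u + x / √N) atTop (𝓝 (tsad u)) := by
      simpa using (tendsto_const_nhds (x := tsad u)).add ((tendsto_const_nhds (x := x)).div_atTop h1)
    have he0 : Tendsto (fun N : ℕ => e N (tsad u + x / √N)) atTop (𝓝 0) := by
      refine squeeze_zero_norm' (a := fun N : ℕ => C / N) ?_ (tendsto_const_div_atTop_nhds_zero_nat C)
      filter_upwards [eventually_ne_atTop 0] with N hN using he N hN _
    have hE0 : Tendsto (fun N : ℕ => efun u N ((tsad u + x / √N : ℝ) * I)) atTop (𝓝 0) := by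
      rw [tendsto_zero_iff_norm_tendsto_zero]
      simp only [hnorm]
      refine Real.tendsto_exp_neg_atTop_nhds_zero.comp ?_
      refine Tendsto.const_mul_atTop (by positivity) ?_
      exact tendsto_natCast_atTop_atTop.atTop_mul_pos ht.1 hpos
    have h2 : Tendsto (fun N : ℕ => exp (-u / 2 + e N (tsad u + x / √N)) /
        (1 + efun u N ((tsad u + x / √N : ℝ) * I))) atTop (𝓝 (exp (-u / 2 + 0) / (1 + 0))) :=
      ((Complex.continuous_exp.tendsto _).comp (he0.const_add _)).div (hE0.const_add _) (by simp)
    rw [add_zero, add_zero, div_one] at h2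
    refine h2.congr' ?_
    filter_upwards [eventually_ne_atTop 0] with N hN
    exact (heg N hN _).symm

lemma one_sub_exp_re_pos {z : ℂ} (hz : z.re < 0) : 0 < (1 - exp z).re := by
  have h1 := (abs_le.mp (abs_re_le_norm (exp z))).2
  rw [Complex.norm_exp] at h1
  have h2 : Real.exp z.re < 1 := Real.exp_lt_one_iff.mpr hz
  rw [sub_re, one_re]
  linarith

lemma im_log_le_pi_div_two {z : ℂ} (hz : 0 ≤ z.re) : (log z).im ≤ Real.pi / 2 := by
  rw [log_im]
  exact (abs_le.mp (abs_arg_le_pi_div_two_iff.mpr hz)).2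

lemma im_log_nonpos {z : ℂ} (hz : 0 ≤ z.re) (hz' : z.im ≤ 0) : (log z).im ≤ 0 := by
  rw [log_im, arg_of_re_nonneg hz, Real.arcsin_nonpos]
  exact div_nonpos_of_nonpos_of_nonneg hz' (norm_nonneg _)

lemma hasDerivAt_im_li_horizontal {v : ℝ} (hv : 0 < v) (t : ℝ) :
    HasDerivAt (fun v : ℝ => (li (-v - t * I)).im) (log (1 - exp (-v - t * I))).im v := by
  have h1 : HasDerivAt (fun v : ℝ => (-v - t * I : ℂ)) (-1) v := by
    simpa using (hasDerivAt_id v).ofReal_comp.neg.sub_const (t * I : ℂ)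
  have h2 := hasDerivAt_li (v := -v - t * I) (by simpa using hv)
  have h3 := imCLM.hasFDerivAt.comp_hasDerivAt v (h2.comp v h1)
  refine h3.congr_deriv ?_
  simp

lemma im_li_sub_le {a b c t : ℝ} (ha : 0 < a) (hab : a ≤ b)
    (h : ∀ v, a ≤ v → (log (1 - exp (-v - t * I))).im ≤ c) :
    (li (-b - t * I)).im - (li (-a - t * I)).im ≤ c * (b - a) := by
  refine Convex.image_sub_le_mul_sub_of_deriv_le (convex_Icc a b)
    (f := fun v : ℝ => (li (-v - t * I)).im) ?_ ?_ ?_ a ⟨le_rfl, hab⟩ b ⟨hab, le_rfl⟩ hab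
  · exact fun v hv => (hasDerivAt_im_li_horizontal (ha.trans_le hv.1) t).continuousAt.continuousWithinAt
  · rw [interior_Icc]
    exact fun v hv => (hasDerivAt_im_li_horizontal (ha.trans hv.1) t).differentiableAt.differentiableWithinAt
  · intro v hv
    rw [interior_Icc] at hv
    rw [(hasDerivAt_im_li_horizontal (ha.trans hv.1) t).deriv]
    exact h v hv.1.le

lemma im_li_three_sub_le {u : ℝ} (hu : 0 < u) (t : ℝ) :
    (li (-(3 * u : ℝ) - t * I)).im - (li (-u - t * I)).im ≤ Real.pi * u := by
  have h := im_li_sub_le (a := u) (b := 3 * u) (c := Real.pi / 2) (t := t) hu (by linarith) fun v hv =>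
    im_log_le_pi_div_two (one_sub_exp_re_pos (by simp; linarith)).le
  linarith

lemma im_li_three_sub_nonpos {u : ℝ} (hu : 0 < u) {t : ℝ} (h0 : Real.pi ≤ t)
    (h1 : t ≤ 2 * Real.pi) :
    (li (-(3 * u : ℝ) - t * I)).im - (li (-u - t * I)).im ≤ 0 := by
  have hs : Real.sin t ≤ 0 := by
    have := Real.sin_nonneg_of_nonneg_of_le_pi (x := 2 * Real.pi - t) (by linarith) (by linarith)
    rw [Real.sin_two_pi_sub] at this
    linarith
  have h := im_li_sub_le (a := u) (b := 3 * u) (c := 0) (t := t) hu (by linarith) fun v hv => by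
    refine im_log_nonpos (one_sub_exp_re_pos (by simp; linarith)).le ?_
    rw [sub_im, one_im, exp_im]
    have e1 : (-(v:ℂ) - t * I).im = -t := by simp
    rw [e1, Real.sin_neg]
    have := Real.exp_pos (-(v:ℂ) - t * I).re
    nlinarith
  linarith

lemma rate_far_right_le {u t a₁ a₂ b₁ b₂ V : ℝ} (hu : 0 < u) (hu1 : u < 1) (ht0 : 0 ≤ t)
    (ht1 : t ≤ 2 * Real.pi) (ha₁ : a₁ ≤ Real.pi ^ 2 / 6) (ha₂ : a₂ ≤ Real.pi ^ 2 / 6)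
    (hb : b₁ - b₂ ≤ Real.pi * u) (hb' : Real.pi ≤ t → b₁ - b₂ ≤ 0) (hV : u * t + 2 * b₂ ≤ V) :
    u * (2 * u ^ 2 + 2 * Real.pi * t) + xiSq u / 2 * u + u * (a₁ + a₂) + 2 * Real.pi * (b₁ + b₂) -
      u * (Real.pi ^ 2 / 3 - Real.pi * (2 * Real.pi - t) + (2 * Real.pi - t) ^ 2 / 2) -
      (8 * Real.pi ^ 2 * u - 2 * Real.pi * u * t) ≤ 2 * Real.pi * V - u := by
  have hpi := Real.pi_gt_three
  have h1 := mul_le_mul_of_nonneg_left hV (by positivity : 0 ≤ 2 * Real.pi)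
  have h2 := mul_le_mul_of_nonneg_left (add_le_add ha₁ ha₂) hu.le
  have h3 : 2 * Real.pi * (b₁ - b₂) + u * (5 / 2 + 1) ≤
      u * (2 * Real.pi ^ 2 + Real.pi * (2 * Real.pi - t) + (2 * Real.pi - t) ^ 2 / 2) := by
    have e0 : 0 ≤ u * (2 * Real.pi - t) ^ 2 := by positivity
    have e9 : 9 * u ≤ Real.pi ^ 2 * u := by gcongr; nlinarith
    rcases le_total Real.pi t with h | h
    · have e1 := mul_le_mul_of_nonneg_left (hb' h) (by positivity : 0 ≤ 2 * Real.pi)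
      have e2 : 0 ≤ u * Real.pi * (2 * Real.pi - t) := by
        have := sub_nonneg.mpr ht1
        positivity
      linarith
    · have e1 := mul_le_mul_of_nonneg_left hb (by positivity : 0 ≤ 2 * Real.pi)
      have e2 := mul_le_mul_of_nonneg_left h (by positivity : 0 ≤ u * Real.pi)
      linarith
  have h4 : u ^ 3 ≤ u * 1 := by
    rw [pow_succ']
    gcongr
    nlinarith
  rw [xiSq]
  linarith

lemma exists_norm_gfun_le_far_right {u : ℝ} (hu : 0 < u) (hu1 : u < 1)
    (hu3 : Real.exp u + Real.exp (-u) < 3) :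
    ∃ C : ℝ, 0 < C ∧ ∀ N : ℕ, N ≠ 0 → ∀ t : ℝ, 0 ≤ t → t ≤ 2 * Real.pi →
      ‖gfun u N (2 * u + t * I)‖ ≤ Real.exp (C + N / xiSq u *
        (8 * Real.pi ^ 2 * u - 2 * Real.pi * u * t + (2 * Real.pi * hfun u (tsad u) - u))) := by
  obtain ⟨C, hC, h⟩ := exists_abs_ell_re_sub_le hu
  have hR := xiSq_pos u
  refine ⟨4 * C, by positivity, fun N hN t h0 h1 => ?_⟩
  have hN' : (N:ℝ) ≠ 0 := by positivity
  have hNu : (N:ℝ) * (u / N) = u := by field_simp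
  set τ : ℝ := 2 * Real.pi - t with hτ
  have hstep : (N:ℂ) * step u N = u + 2 * Real.pi * I := by
    rw [natCast_mul_step u hN, xi]
  have hv : N * (u / N) ≤ ((u:ℂ) + t * I).re := by
    rw [hNu]; simp
  rw [norm_gfun, qdk, norm_mul, show (2 * u + t * I - u : ℂ) = u + t * I by ring,
    norm_prod_one_sub_exp hu hN N hv, Complex.norm_exp, ← Real.exp_add, ← Real.exp_add,
    Real.exp_le_exp, hstep, show (u + t * I - (u + 2 * Real.pi * I) : ℂ) = -(τ * I) by
      rw [hτ]; push_cast; ring,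
    show (-(u + t * I) + (u + 2 * Real.pi * I) : ℂ) = τ * I by rw [hτ]; push_cast; ring,
    show (-u - (2 * u + t * I) : ℂ) = -(3 * u : ℝ) - t * I by push_cast; ring,
    show (-(u + t * I) : ℂ) = -u - t * I by ring, neg_re]
  have A1 := abs_le.mp (h N hN (-(3 * u : ℝ) - t * I) (by simp; linarith))
  have A2 := abs_le.mp (h N hN (-u - t * I) (by simp; linarith))
  have A3 := abs_le.mp (h N hN (τ * I) (by simp))
  have A4 := abs_le.mp (h N hN (-(τ * I)) (by simp))
  have hsum : rate u (li (τ * I)) + rate u (li (-(τ * I))) =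
      u * (Real.pi ^ 2 / 3 - Real.pi * τ + τ ^ 2 / 2) := by
    rw [← rate_add, li_I_add_li_neg_I (by rw [hτ]; linarith) (by rw [hτ]; linarith), rate, ofReal_re,
      ofReal_im]
    ring
  have hconj : (li (-u - t * I)).im = -(li (-u + t * I)).im := by
    rw [← conj_im, ← li_conj]
    congr 2
    simp [sub_eq_add_neg]
  have hV : u * t + 2 * (li (-u - t * I)).im ≤ hfun u (tsad u) := by
    have : hfun u t ≤ hfun u (tsad u) := by
      rcases eq_or_ne t (tsad u) with rfl | hne
      · exact le_rfl
      · exact (hfun_lt hu hu3 h0 h1 hne).le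
    rw [hconj]
    rw [hfun] at this
    linarith
  have hre : ∀ v : ℝ, 0 ≤ v → (li (-v - t * I)).re ≤ Real.pi ^ 2 / 6 := fun v hv =>
    (re_le_norm _).trans (norm_li_le (by simpa using hv))
  have key := rate_far_right_le hu hu1 h0 h1 (hre (3 * u) (by positivity)) (hre u hu.le)
    (im_li_three_sub_le hu t) (fun h => im_li_three_sub_nonpos hu h h1) hV
  have key2 := mul_le_mul_of_nonneg_left key (by positivity : 0 ≤ N / xiSq u)
  have hr1 : rate u (2 * u + t * I) = 2 * u ^ 2 + 2 * Real.pi * t := by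
    simp [rate]; ring
  have hvre : ((u:ℂ) + t * I).re = u := by simp
  have hx : N / xiSq u * (xiSq u / 2 * u) = N * u / 2 := by field_simp
  have hx2 : (N:ℝ) ^ 2 / 2 * (u / N) = N * u / 2 := by field_simp
  have hs2 := congrArg (fun x => N / xiSq u * x) hsum
  simp only [mul_add] at hs2
  rw [hr1, hvre, hx2]
  simp only [rate] at A1 A2 A3 A4 hs2
  rw [← hτ] at key2
  simp only [mul_add, mul_sub] at *
  linarith [A1.2, A2.2, A3.1, A4.1]

lemma tendsto_natCast_div_xiSq (u : ℝ) : Tendsto (fun N : ℕ => N / xiSq u) atTop atTop :=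
  tendsto_natCast_atTop_atTop.atTop_div_const (xiSq_pos u)

lemma exists_norm_integral_kfun_far_right_le {u : ℝ} (hu : 0 < u) (hu1 : u < 1)
    (hu3 : Real.exp u + Real.exp (-u) < 3) :
    ∃ C : ℝ, 0 < C ∧ ∀ᶠ N : ℕ in atTop,
      ‖∫ t in (0:ℝ)..(2 * Real.pi), kfun u N (2 * u + t * I)‖ ≤
        C * Real.exp (N / xiSq u * (2 * Real.pi * hfun u (tsad u) - u)) := by
  obtain ⟨C, hC, h⟩ := exists_norm_gfun_le_far_right hu hu1 hu3
  have hpi := Real.pi_pos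
  refine ⟨2 * Real.exp C * (2 * Real.pi), by positivity, ?_⟩
  have hlarge : ∀ᶠ N : ℕ in atTop, 1 ≤ N / xiSq u * (4 * Real.pi ^ 2 * u) :=
    ((tendsto_natCast_div_xiSq u).atTop_mul_const (by positivity)).eventually_ge_atTop 1
  filter_upwards [hlarge, eventually_ne_atTop 0] with N hlarge hN
  have hR := xiSq_pos u
  set X := Real.exp (N / xiSq u * (2 * Real.pi * hfun u (tsad u) - u))
  have hX : 0 < X := Real.exp_pos _
  have hb : ∀ t : ℝ, 0 ≤ t → t ≤ 2 * Real.pi →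
      ‖kfun u N (2 * u + t * I)‖ ≤ 2 * Real.exp C * X := by
    intro t h0 h1
    have hE : ‖efun u N (2 * u + t * I)‖ =
        Real.exp (N / xiSq u * (8 * Real.pi ^ 2 * u - 2 * Real.pi * u * t)) := by
      rw [efun, Complex.norm_exp, mul_left_comm, div_xi_mul_re, rate]
      congr 2
      simp
      ring
    have hE2 : 2 ≤ ‖efun u N (2 * u + t * I)‖ := by
      rw [hE]
      have e1 : N / xiSq u * (4 * Real.pi ^ 2 * u) ≤
          N / xiSq u * (8 * Real.pi ^ 2 * u - 2 * Real.pi * u * t) := by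
        gcongr
        have := mul_le_mul_of_nonneg_left h1 (by positivity : 0 ≤ 2 * Real.pi * u)
        linarith
      have e2 := Real.add_one_le_exp (N / xiSq u * (8 * Real.pi ^ 2 * u - 2 * Real.pi * u * t))
      linarith
    have hden : ‖efun u N (2 * u + t * I)‖ / 2 ≤ ‖1 + efun u N (2 * u + t * I)‖ := by
      have := norm_sub_le (1 + efun u N (2 * u + t * I)) 1
      rw [add_sub_cancel_left, norm_one] at this
      linarith
    rw [kfun, norm_div, div_le_iff₀ (by linarith)]
    have hg := h N hN t h0 h1
    rw [mul_add, Real.exp_add, Real.exp_add, ← hE] at hg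
    have := mul_le_mul_of_nonneg_left hden (by positivity : 0 ≤ 2 * Real.exp C * X)
    refine hg.trans (le_trans (le_of_eq ?_) this)
    simp only [X]
    ring
  refine (intervalIntegral.norm_integral_le_of_norm_le_const (C := 2 * Real.exp C * X)
    fun t ht => ?_).trans (le_of_eq ?_)
  · rw [Set.uIoc_of_le (by positivity)] at ht
    exact hb t ht.1.le ht.2
  · rw [sub_zero, abs_of_pos (by positivity)]
    ring

lemma one_sub_ofReal_mul_mem_slitPlane {z : ℂ} (hz : z.im ≠ 0) (s : ℝ) :
    1 - (s:ℂ) * z ∈ slitPlane := by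
  rcases eq_or_ne s 0 with rfl | hs
  · simp
  · right
    simp [hs, hz]

lemma hasDerivAt_log_one_sub_ofReal_mul {z : ℂ} (hz : z.im ≠ 0) (s : ℝ) :
    HasDerivAt (fun s : ℝ => log (1 - (s:ℂ) * z)) (-z / (1 - (s:ℂ) * z)) s := by
  have h1 : HasDerivAt (fun s : ℝ => 1 - (s:ℂ) * z) (-z) s := by
    simpa using ((hasDerivAt_id s).ofReal_comp.mul_const z).const_sub 1
  exact h1.clog_real (one_sub_ofReal_mul_mem_slitPlane hz s)

lemma intervalIntegrable_log_one_sub_div {z : ℂ} (hz : z.im ≠ 0) (b : ℝ) :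
    IntervalIntegrable (fun s : ℝ => log (1 - (s:ℂ) * z) / (s:ℂ)) volume 0 b := by
  have hc : Continuous (dslope (fun s : ℝ => log (1 - (s:ℂ) * z)) 0) := by
    rw [← continuousOn_univ, continuousOn_dslope univ_mem]
    exact ⟨fun s _ => (hasDerivAt_log_one_sub_ofReal_mul hz s).continuousAt.continuousWithinAt,
      (hasDerivAt_log_one_sub_ofReal_mul hz 0).differentiableAt⟩
  refine (hc.intervalIntegrable 0 b).congr_ae ?_
  refine ae_restrict_of_ae ?_
  filter_upwards [compl_mem_ae_iff.mpr (measure_singleton (0:ℝ))] with s hs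
  rw [dslope_of_ne _ hs, slope_def_module]
  simp [div_eq_inv_mul]

lemma dilog_ofReal_mul {z : ℂ} {r : ℝ} (hr : 0 < r) :
    dilog (r * z) = -∫ s in (0:ℝ)..r, log (1 - (s:ℂ) * z) / (s:ℂ) := by
  have h := intervalIntegral.integral_comp_mul_left (a := 0) (b := 1)
    (fun s : ℝ => log (1 - (s:ℂ) * z) / (s:ℂ)) hr.ne'
  rw [mul_zero, mul_one, eq_inv_smul_iff₀ hr.ne'] at h
  rw [dilog, ← h, ← intervalIntegral.integral_smul]
  congr 1
  refine intervalIntegral.integral_congr fun t _ => ?_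
  have hr' : (r:ℂ) ≠ 0 := ofReal_ne_zero.mpr hr.ne'
  simp only [real_smul]
  push_cast
  rw [show (t:ℂ) * (r * z) = r * t * z by ring, ← mul_div_assoc, mul_div_mul_left _ _ hr']

lemma dilog_conj (z : ℂ) (hz : z.im ≠ 0) : dilog (starRingEnd ℂ z) = starRingEnd ℂ (dilog z) := by
  rw [dilog, dilog, map_neg, ← intervalIntegral.intervalIntegral_conj]
  congr 1
  refine intervalIntegral.integral_congr fun t _ => ?_
  have h : (1 - (t:ℂ) * z).arg ≠ Real.pi :=
    slitPlane_arg_ne_pi (one_sub_ofReal_mul_mem_slitPlane hz t)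
  simp only [map_div₀, conj_ofReal]
  rw [← log_conj _ h]
  simp

lemma li_log_add {s : ℝ} (hs : 0 < s) (v : ℂ) :
    li (Real.log s + v) = ∑' n : ℕ, ((s:ℂ) * exp v) ^ (n + 1) / ((n:ℂ) + 1) ^ 2 := by
  rw [li]
  congr 1
  ext n
  rw [show (s:ℂ) * exp v = exp (Real.log s + v) by
    rw [Complex.exp_add, ← ofReal_exp, Real.exp_log hs], ← Complex.exp_nat_mul]
  push_cast
  rfl

lemma hasDerivAt_li_log_add {s θ : ℝ} (h0 : 0 < s) (h1 : s < 1) :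
    HasDerivAt (fun s : ℝ => li (Real.log s + θ * I))
      (-(log (1 - (s:ℂ) * exp (θ * I)) / (s:ℂ))) s := by
  have h := hasDerivAt_li (v := Real.log s + θ * I) (by simpa using Real.log_neg h0 h1)
  have h2 : HasDerivAt (fun s : ℝ => (Real.log s + θ * I : ℂ)) ((s:ℂ)⁻¹) s := by
    simpa using (Real.hasDerivAt_log h0.ne').ofReal_comp.add_const (θ * I : ℂ)
  refine (h.comp s h2).congr_deriv ?_
  rw [Complex.exp_add, ← ofReal_exp, Real.exp_log h0]
  ring

lemma exp_ofReal_mul_I_im_pos {θ : ℝ} (h0 : 0 < θ) (h1 : θ < Real.pi) : 0 < (exp (θ * I)).im := by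
  rw [exp_ofReal_mul_I_im]
  exact Real.sin_pos_of_pos_of_lt_pi h0 h1

lemma dilog_exp_mul_I {θ : ℝ} (h0 : 0 < θ) (h1 : θ < Real.pi) :
    dilog (exp (θ * I)) = li (θ * I) := by
  set z := exp (θ * I)
  have hz : z.im ≠ 0 := (exp_ofReal_mul_I_im_pos h0 h1).ne'
  have hzn : ‖z‖ = 1 := norm_exp_ofReal_mul_I θ
  set P : ℝ → ℂ := fun s => ∑' n : ℕ, ((s:ℂ) * z) ^ (n + 1) / ((n:ℂ) + 1) ^ 2
  have hP : ContinuousOn P (Set.Icc 0 1) := by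
    refine continuousOn_tsum (u := fun n : ℕ => 1 / ((n:ℝ) + 1) ^ 2) (fun n => ?_)
      hasSum_one_div_succ_sq.summable fun n s hs => ?_
    · fun_prop
    · rw [norm_div, norm_pow, norm_pow, norm_natCast_add_one, norm_mul, hzn, norm_real,
        Real.norm_of_nonneg hs.1, mul_one]
      gcongr
      exact pow_le_one₀ hs.1 hs.2
  have hd : ∀ s ∈ Set.Ioo (0:ℝ) 1, HasDerivAt P (-(log (1 - (s:ℂ) * z) / (s:ℂ))) s := by
    intro s hs
    refine (hasDerivAt_li_log_add (θ := θ) hs.1 hs.2).congr_of_eventuallyEq ?_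
    filter_upwards [lt_mem_nhds hs.1] with x hx
    exact (li_log_add hx _).symm
  have h := intervalIntegral.integral_eq_sub_of_hasDerivAt_of_le zero_le_one hP hd
    (intervalIntegrable_log_one_sub_div hz 1).neg
  rw [intervalIntegral.integral_neg] at h
  have e0 : P 0 = 0 := by simp [P]
  have e1 : P 1 = li (θ * I) := by
    have := li_log_add one_pos (θ * I)
    simpa [P, z] using this.symm
  rw [dilog, h, e0, e1, sub_zero]

lemma im_log_one_sub_add {r θ : ℝ} (hr : 1 < r) (h0 : 0 < θ) (h1 : θ < Real.pi) :
    (log (1 - (r:ℂ) * exp (θ * I))).im + (log (1 - (r⁻¹:ℝ) * exp (θ * I))).im = θ - Real.pi := by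
  have hr0 : 0 < r := one_pos.trans hr
  set z := exp (θ * I) with hz
  have hzim : 0 < z.im := exp_ofReal_mul_I_im_pos h0 h1
  set w : ℂ := 1 - (r⁻¹:ℝ) * z with hw
  have hwim : w.im < 0 := by
    simp only [hw, sub_im, one_im, im_ofReal_mul]
    have : 0 < r⁻¹ * z.im := by positivity
    linarith
  have hzre : z.re < 1 := by
    have h := normSq_apply z
    rw [normSq_eq_norm_sq, hz, norm_exp_ofReal_mul_I θ, ← hz] at h
    nlinarith [sq_nonneg (z.re - 1), mul_pos hzim hzim]
  have hwre : 0 < w.re := by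
    simp only [hw, sub_re, one_re, re_ofReal_mul]
    have h2 : r⁻¹ < 1 := inv_lt_one_of_one_lt₀ hr
    have h3 : 0 < r⁻¹ := by positivity
    nlinarith
  have ha := (abs_lt.mp (abs_arg_lt_pi_div_two_iff.mpr (Or.inl hwre)))
  have han : arg w < 0 := arg_neg_iff.mpr hwim
  have hconj : arg (starRingEnd ℂ w) = -arg w := by
    rw [arg_conj, if_neg (by linarith [ha.2, Real.pi_pos])]
  have hx : arg ((r:ℂ) * exp ((θ - Real.pi : ℝ) * I)) = θ - Real.pi := by
    rw [arg_real_mul _ hr0, arg_exp_mul_I, toIocMod_eq_self]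
    constructor <;> linarith
  have hprod : 1 - (r:ℂ) * z = ((r:ℂ) * exp ((θ - Real.pi : ℝ) * I)) * starRingEnd ℂ w := by
    have e1 : exp ((θ - Real.pi : ℝ) * I) = -z := by
      push_cast
      rw [sub_mul, Complex.exp_sub, exp_pi_mul_I, ← hz]
      rw [div_neg, div_one]
    have e2 : z * starRingEnd ℂ z = 1 := by
      rw [mul_conj, normSq_eq_norm_sq, hz, norm_exp_ofReal_mul_I]; simp
    have hr' : (r:ℂ) ≠ 0 := ofReal_ne_zero.mpr hr0.ne'
    rw [e1, hw]
    simp only [map_sub, map_one, map_mul, conj_ofReal]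
    push_cast
    field_simp
    linear_combination -e2
  have hw0 : starRingEnd ℂ w ≠ 0 := by
    rw [Ne, map_eq_zero]
    intro h
    rw [h] at hwre
    simp at hwre
  rw [log_im, log_im, hprod, arg_mul (mul_ne_zero (ofReal_ne_zero.mpr hr0.ne') (exp_ne_zero _)) hw0,
    hx, hconj]
  · ring
  · rw [hx, hconj]
    constructor <;> linarith [ha.1]

lemma im_dilog_exp {u θ : ℝ} (hu : 0 < u) (h0 : 0 < θ) (h1 : θ < Real.pi) :
    (dilog (exp (u + θ * I))).im = (li (-u + θ * I)).im + u * (Real.pi - θ) := by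
  set z := exp (θ * I)
  have hz : z.im ≠ 0 := (exp_ofReal_mul_I_im_pos h0 h1).ne'
  have hr : 1 < Real.exp u := Real.one_lt_exp_iff.mpr hu
  set f : ℝ → ℂ := fun s : ℝ => log (1 - (s:ℂ) * z) / (s:ℂ) with hf
  have hfi := intervalIntegrable_log_one_sub_div hz
  have hfi1 : IntervalIntegrable f volume 1 (Real.exp u) := (hfi 1).symm.trans (hfi _)
  have hfi2 : IntervalIntegrable (fun s => (f s).im) volume 1 (Real.exp u) :=
    ⟨hfi1.1.im, hfi1.2.im⟩
  set Q : ℝ → ℝ := fun s => (li (Real.log s⁻¹ + θ * I)).im + Real.log s * (Real.pi - θ) with hQ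
  have hd : ∀ s ∈ Set.Ioo (1:ℝ) (Real.exp u), HasDerivAt Q (-(f s).im) s := by
    intro s hs
    have hs0 : 0 < s := one_pos.trans hs.1
    have e1 := hasDerivAt_li_log_add (θ := θ) (s := s⁻¹) (by positivity)
      (inv_lt_one_of_one_lt₀ hs.1)
    have e2 := e1.scomp s (hasDerivAt_inv hs0.ne')
    have e3 := imCLM.hasFDerivAt.comp_hasDerivAt s e2
    have e4 := e3.add ((Real.hasDerivAt_log hs0.ne').mul_const (Real.pi - θ))
    refine e4.congr_deriv ?_
    have key := im_log_one_sub_add hs.1 h0 h1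
    simp only [hf, imCLM_apply, smul_im, smul_eq_mul, neg_im]
    rw [div_ofReal_im, div_ofReal_im]
    change _ + _ = θ - Real.pi at key
    rw [← one_div s] at key ⊢
    field_simp
    linear_combination key
  have hc : ContinuousOn Q (Set.Icc 1 (Real.exp u)) := by
    have hl : ContinuousOn (fun s : ℝ => Real.log s) (Set.Icc 1 (Real.exp u)) :=
      Real.continuousOn_log.mono fun s hs => by
        have := hs.1
        simp only [Set.mem_compl_iff, Set.mem_singleton_iff]
        linarith
    refine ContinuousOn.add (continuous_im.comp_continuousOn
      (continuousOn_li.comp (f := fun s : ℝ => (Real.log s⁻¹ + θ * I : ℂ)) ?_ ?_)) ?_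
    · simp only [Real.log_inv]
      exact (continuous_ofReal.comp_continuousOn hl.neg).add continuousOn_const
    · intro s hs
      have := Real.log_nonneg hs.1
      simpa using this
    · exact hl.mul continuousOn_const
  have h := intervalIntegral.integral_eq_sub_of_hasDerivAt_of_le hr.le hc hd hfi2.neg
  rw [intervalIntegral.integral_neg] at h
  have him : ∫ s in (1:ℝ)..Real.exp u, (f s).im = (∫ s in (1:ℝ)..Real.exp u, f s).im :=
    imCLM.intervalIntegral_comp_comm hfi1
  have e1 : dilog (exp (u + θ * I)) = li (θ * I) - ∫ s in (1:ℝ)..Real.exp u, f s := by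
    rw [← dilog_exp_mul_I h0 h1, Complex.exp_add, ← ofReal_exp, dilog_ofReal_mul (Real.exp_pos u),
      ← intervalIntegral.integral_add_adjacent_intervals (hfi 1) hfi1, dilog]
    ring
  rw [e1, sub_im, ← him]
  simp only [hQ, Real.log_inv, Real.log_exp, Real.log_one] at h
  push_cast at h
  simp only [neg_zero, zero_mul, zero_add, add_zero] at h
  linarith

lemma hfun_tsad (u : ℝ) :
    hfun u (tsad u) = u * (2 * Real.pi - theta u) + 2 * (li (-u + theta u * I)).im := by
  have h : li (-u + tsad u * I) = starRingEnd ℂ (li (-u + theta u * I)) := by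
    rw [← li_conj, ← li_add_two_pi (starRingEnd ℂ _), tsad]
    congr 1
    simp
    ring
  rw [hfun, h, conj_im, tsad]
  ring

lemma sin_theta_pos {u : ℝ} (hu : 0 < u) (hu3 : Real.exp u + Real.exp (-u) < 3) :
    0 < Real.sin (theta u) :=
  Real.sin_pos_of_pos_of_lt_pi (theta_pos hu3) (by linarith [theta_lt hu, Real.pi_pos])

lemma betaRoot_eq {u : ℝ} (hu : 0 < u) (hu3 : Real.exp u + Real.exp (-u) < 3) :
    betaRoot u = I * (2 * Real.sin (theta u) : ℝ) := by
  have hs := sin_theta_pos hu hu3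
  have hc := cos_theta hu3
  rw [Real.cosh_eq] at hc
  rw [betaRoot, ← Real.sqrt_sq (by positivity : 0 ≤ 2 * Real.sin (theta u))]
  congr 3
  have h1 := Real.sin_sq_add_cos_sq (theta u)
  rw [hc] at h1
  linear_combination -4 * h1

lemma phiu_eq {u : ℝ} (hu : 0 < u) (hu3 : Real.exp u + Real.exp (-u) < 3) :
    phiu u = -(theta u * I) := by
  have hc := cos_theta hu3
  rw [Real.cosh_eq] at hc
  have h : (((Real.exp u + Real.exp (-u) - 1 : ℝ) : ℂ) - betaRoot u) / 2 = exp (-(theta u * I)) := by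
    rw [betaRoot_eq hu hu3, show Real.exp u + Real.exp (-u) - 1 = 2 * Real.cos (theta u) by
      rw [hc]; ring, ← neg_mul, Complex.exp_mul_I, Complex.cos_neg, Complex.sin_neg]
    push_cast
    ring
  have hpi := Real.pi_pos
  have h1 := theta_lt hu
  have h2 := theta_pos hu3
  rw [phiu, h, Complex.log_exp] <;> simp <;> linarith

lemma Su_eq {u : ℝ} (hu : 0 < u) (hu3 : Real.exp u + Real.exp (-u) < 3) :
    Su u = I * hfun u (tsad u) := by
  have h0 := theta_pos hu3
  have h1 : theta u < Real.pi := by linarith [theta_lt hu, Real.pi_pos]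
  have him : (exp (u + theta u * I)).im ≠ 0 := by
    rw [exp_im]
    have := sin_theta_pos hu hu3
    simp [this.ne']
  have hconj : dilog (exp (u - theta u * I)) = starRingEnd ℂ (dilog (exp (u + theta u * I))) := by
    rw [← dilog_conj _ him, ← Complex.exp_conj]
    simp [sub_eq_add_neg]
  rw [Su, phiu_eq hu hu3, sub_neg_eq_add, ← sub_eq_add_neg, hconj, hfun_tsad, sub_conj,
    im_dilog_exp hu h0 h1]
  push_cast
  ring

lemma tendsto_sqrt_mul_exp_mul_of_le {u V a A C : ℝ} {f : ℕ → ℂ} (ha : a < 2 * Real.pi * V)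
    (h : ∀ᶠ N : ℕ in atTop, ‖f N‖ ≤ C * Real.exp (A * √N + N / xiSq u * a)) :
    Tendsto (fun N : ℕ => (√N : ℂ) * exp (-(N * (I / xi u) * V)) * f N) atTop (𝓝 0) := by
  have hR := xiSq_pos u
  set δ := (2 * Real.pi * V - a) / xiSq u
  have hδ : 0 < δ := div_pos (by linarith) hR
  have hx : Tendsto (fun N : ℕ => √(N:ℝ)) atTop atTop :=
    Real.tendsto_sqrt_atTop.comp tendsto_natCast_atTop_atTop
  have hlim : Tendsto (fun x : ℝ => C * Real.exp (x * (A + 1 + -δ * x))) atTop (𝓝 0) := by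
    rw [← mul_zero C]
    refine (Real.tendsto_exp_atBot.comp ?_).const_mul C
    refine tendsto_id.atTop_mul_atBot₀ ?_
    exact tendsto_atBot_add_const_left _ _ (tendsto_id.const_mul_atTop_of_neg (by linarith))
  refine squeeze_zero_norm' ?_ (hlim.comp hx)
  filter_upwards [h] with N hN
  have hre : (-(N * (I / xi u) * V) : ℂ).re = -(N * (2 * Real.pi / xiSq u) * V) := by
    rw [neg_re, re_mul_ofReal, ← I_div_xi_re, ← ofReal_natCast, re_ofReal_mul]
  rw [norm_mul, norm_mul, Complex.norm_exp, hre, norm_real, Real.norm_of_nonneg (Real.sqrt_nonneg _)]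
  have hs : √(N:ℝ) ≤ Real.exp √(N:ℝ) := by linarith [Real.add_one_le_exp √(N:ℝ)]
  calc _ ≤ Real.exp √(N:ℝ) * Real.exp (-(N * (2 * Real.pi / xiSq u) * V)) *
        (C * Real.exp (A * √N + N / xiSq u * a)) := by gcongr
    _ = C * Real.exp (√N + -(N * (2 * Real.pi / xiSq u) * V) + (A * √N + N / xiSq u * a)) := by
      rw [Real.exp_add (√(N:ℝ) + _), Real.exp_add √(N:ℝ)]; ring
    _ = _ := by
      simp only [Function.comp]
      congr 2
      have := Real.mul_self_sqrt (Nat.cast_nonneg (α := ℝ) N)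
      simp only [δ]
      field_simp
      linear_combination (2 * Real.pi * V - a) * this

lemma mul_cpow_half_eq_one {u s : ℝ} (hu : 0 < u) (hs : 0 < s) {c : ℂ}
    (hc : c ^ 2 = -xi u * (I * (2 * s : ℝ))) (hcre : 0 < c.re) (hcim : c.im < 0) :
    c * (I / xi u) * (Real.pi / (I / xi u * s)) ^ (1 / 2 : ℂ) / √(2 * Real.pi) = 1 := by
  have hpi := Real.pi_pos
  have hxi := xi_ne_zero u
  have hsc : (s:ℂ) ≠ 0 := ofReal_ne_zero.mpr hs.ne'
  have hpic : (Real.pi:ℂ) ≠ 0 := ofReal_ne_zero.mpr hpi.ne'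
  have hq : (Real.pi / (I / xi u * s) : ℂ) = (Real.pi / s : ℝ) * (2 * Real.pi - u * I) := by
    rw [xi] at *
    push_cast
    field_simp
    linear_combination (u:ℂ) * I_sq
  set p := (Real.pi / (I / xi u * s) : ℂ) ^ (1 / 2 : ℂ) with hp
  have hp2 : p ^ 2 = (Real.pi / s : ℝ) * (2 * Real.pi - u * I) := by
    rw [hp, ← hq, one_div]
    exact_mod_cast cpow_nat_inv_pow _ two_ne_zero
  have hq0 : 0 < ((Real.pi / s : ℝ) * (2 * Real.pi - u * I) : ℂ).re := by
    rw [re_ofReal_mul]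
    simp
    positivity
  have hq1 : ((Real.pi / s : ℝ) * (2 * Real.pi - u * I) : ℂ).im < 0 := by
    rw [im_ofReal_mul]
    simp
    positivity
  have hpre : 0 < p.re := by
    rw [hp, hq, one_div, cpow_inv_two_re]
    positivity
  have hpim : p.im < 0 := by
    rw [← hp2, sq, mul_im] at hq1
    nlinarith
  have hp0 : p ≠ 0 := fun h => by rw [h] at hpre; simp at hpre
  have hw : I / xi u * p = (Real.pi / s / normSq p : ℝ) * starRingEnd ℂ p := by
    have hn : (normSq p : ℂ) ≠ 0 := by simpa using hp0
    have e1 : I / xi u * p ^ 2 = (Real.pi / s : ℝ) := by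
      rw [hp2, ← hq]
      push_cast
      field_simp
    have e2 := mul_conj p
    refine mul_right_cancel₀ hp0 ?_
    push_cast at e1 ⊢
    rw [mul_assoc, ← sq, e1, mul_assoc, mul_comm _ p, e2]
    field_simp
  have hnp : 0 < normSq p := normSq_pos.mpr hp0
  set L := c * (I / xi u) * p / √(2 * Real.pi) with hL
  have hr : ((√(2 * Real.pi) : ℝ) : ℂ) ^ 2 = 2 * Real.pi := by
    rw [← ofReal_pow, Real.sq_sqrt (by positivity)]
    push_cast
    rfl
  have hL2 : L ^ 2 = 1 := by
    rw [hL, div_pow, mul_pow, mul_pow, hr, hc, hp2, ← hq]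
    push_cast
    field_simp
    linear_combination -I_sq
  have hLre : 0 < L.re := by
    rw [hL, div_ofReal_re, mul_assoc, hw, mul_left_comm, re_ofReal_mul, mul_re, conj_re, conj_im]
    have : 0 < c.re * p.re - c.im * -p.im := by nlinarith [mul_pos hcre hpre]
    positivity
  rcases mul_self_eq_one_iff.mp ((sq L).symm.trans hL2) with h | h
  · exact h
  · rw [h] at hLre
    simp at hLre
    linarith

lemma exp_add_exp_neg_lt_three {u : ℝ} (hu0 : 0 < u) (hu1 : u < Real.log ((3 + √5) / 2)) :
    u < 1 ∧ Real.exp u + Real.exp (-u) < 3 := by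
  have h5 : √5 ^ 2 = 5 := Real.sq_sqrt (by norm_num)
  have h50 := Real.sqrt_nonneg 5
  have h := (Real.lt_log_iff_exp_lt (by positivity)).mp hu1
  have h1 : 1 < Real.exp u := Real.one_lt_exp_iff.mpr hu0
  have h53 : √5 < 2.24 := by nlinarith
  constructor
  · rw [← Real.exp_lt_exp]
    linarith [Real.exp_one_gt_d9]
  · have hm : Real.exp u * Real.exp (-u) = 1 := by rw [← Real.exp_add]; simp
    have : Real.exp u * (Real.exp u + Real.exp (-u)) < Real.exp u * 3 := by
      have h3 : 0 < (Real.exp u - (3 - √5) / 2) * ((3 + √5) / 2 - Real.exp u) := by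
        refine mul_pos ?_ (by linarith)
        nlinarith
      nlinarith
    exact lt_of_mul_lt_mul_left this (by positivity)

lemma JE_mul_eq_integral {u : ℝ} (hu : 0 < u) {N : ℕ} (hN : 2 ≤ N) :
    JE N (exp (xi u / N)) * (1 - exp (-u)) = N / xi u *
      (I * (∫ t in (0:ℝ)..(2 * Real.pi), kfun u N (t * I)) -
        (∫ s in (0:ℝ)..(2 * u), kfun u N s) +
        (∫ s in (0:ℝ)..(2 * u), kfun u N (s + 2 * Real.pi * I)) -
        I * (∫ t in (0:ℝ)..(2 * Real.pi), kfun u N (2 * u + t * I))) := by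
  rw [JE_mul_eq_sum hu hN, sum_gfun_nodes hu (by omega), rectInt]
  simp only [ofReal_zero, zero_mul, zero_add, add_zero, ofReal_mul, ofReal_ofNat]
  ring

theorem tendsto_JE {u : ℝ} (hu : 0 < u) (hu1 : u < 1)
    (hu3 : Real.exp u + Real.exp (-u) < 3) {c : ℂ}
    (hc : c ^ 2 = -xi u * betaRoot u) (hcre : 0 < c.re) (hcim : c.im < 0) :
    Tendsto (fun N : ℕ => JE N (exp (xi u / N)) * (2 * (Real.sinh (u / 2) : ℂ)) * c /
      ((√(2 * Real.pi * N) : ℂ) * exp (N / xi u * Su u))) atTop (𝓝 1) := by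
  have hs := sin_theta_pos hu hu3
  rw [betaRoot_eq hu hu3] at hc
  set V := hfun u (tsad u)
  have hV : 2 * Real.pi * u < V := by
    rw [← hfun_two_pi]
    exact hfun_two_pi_lt hu hu3 (tsad_mem hu hu3).2 le_rfl
  have hpi := Real.pi_pos
  obtain ⟨A, hA, hhor⟩ := norm_integral_kfun_horizontal_le hu hu1 hu3
  obtain ⟨B, hB, hright⟩ := exists_norm_integral_kfun_far_right_le hu hu1 hu3
  have hlt : 4 * Real.pi ^ 2 * u < 2 * Real.pi * V := by
    have := mul_lt_mul_of_pos_left hV (by positivity : 0 < 2 * Real.pi)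
    linarith
  have t1 : Tendsto (fun N : ℕ => (√N : ℂ) * exp (-(N * (I / xi u) * V)) *
      ∫ t in (0:ℝ)..(2 * Real.pi), kfun u N (t * I)) atTop _ := tendsto_integral_kfun_left hu hu3
  have t2 := tendsto_sqrt_mul_exp_mul_of_le (V := V) hlt
    ((eventually_ne_atTop 0).mono fun N hN => (hhor N hN).1)
  have t3 := tendsto_sqrt_mul_exp_mul_of_le (V := V) hlt
    ((eventually_ne_atTop 0).mono fun N hN => (hhor N hN).2)
  have t4 := tendsto_sqrt_mul_exp_mul_of_le (V := V) (a := 2 * Real.pi * V - u) (A := 0)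
    (by linarith) (hright.mono fun N hN => by simpa using hN)
  have t5 := ((((t1.const_mul I).sub t2).add t3).sub (t4.const_mul I)).const_mul
    (exp (u / 2) * c / (xi u * √(2 * Real.pi)))
  have hlim := mul_cpow_half_eq_one hu hs hc hcre hcim
  have e1 : exp ((u:ℂ) / 2) * exp (-u / 2) = 1 := by
    rw [← Complex.exp_add, neg_div, add_neg_cancel, Complex.exp_zero]
  have hval : exp ((u:ℂ) / 2) * c / (xi u * √(2 * Real.pi)) *
      (I * (exp (-u / 2) * (Real.pi / (I / xi u * Real.sin (theta u))) ^ (1 / 2 : ℂ)) - 0 + 0 -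
        I * 0) = 1 := by
    refine Eq.trans ?_ hlim
    linear_combination (c * (I / xi u) * (Real.pi / (I / xi u * Real.sin (theta u))) ^ (1 / 2 : ℂ) /
      √(2 * Real.pi)) * e1
  rw [hval] at t5
  refine t5.congr' ?_
  filter_upwards [eventually_ge_atTop 2] with N hN
  have hJ := JE_mul_eq_integral hu hN
  have hsinh : (2 * (Real.sinh (u / 2) : ℂ)) = exp (u / 2) * (1 - exp (-u)) := by
    rw [ofReal_sinh, Complex.sinh, mul_sub, ← Complex.exp_add]
    push_cast
    rw [show (u / 2 + -u : ℂ) = -(u / 2) by ring]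
    ring
  have hexp : exp (N / xi u * Su u) = exp (N * (I / xi u) * V) := by
    rw [Su_eq hu hu3]
    congr 1
    ring
  have hN0 : (0:ℝ) < N := by positivity
  have hsN : (√(N:ℝ) : ℂ) ≠ 0 := ofReal_ne_zero.mpr (Real.sqrt_pos.mpr hN0).ne'
  have hsp : (√(2 * Real.pi) : ℂ) ≠ 0 :=
    ofReal_ne_zero.mpr (Real.sqrt_pos.mpr (by positivity)).ne'
  have hNN : (N:ℂ) = √(N:ℝ) * √(N:ℝ) := by
    rw [← ofReal_mul, Real.mul_self_sqrt hN0.le, ofReal_natCast]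
  have hxi := xi_ne_zero u
  rw [hsinh, hexp, Real.sqrt_mul (by positivity : 0 ≤ 2 * Real.pi) N,
    Complex.exp_neg (N * (I / xi u) * V)]
  rw [show ∀ x : ℂ, JE N (exp (xi u / N)) * (exp (u / 2) * (1 - exp (-u))) * c / x =
    (JE N (exp (xi u / N)) * (1 - exp (-u))) * exp (u / 2) * c / x by intro x; ring, hJ]
  have hE := exp_ne_zero (N * (I / xi u) * V)
  set E := exp (N * (I / xi u) * V)
  rw [hNN]
  push_cast
  field_simp

/-- asymptotic expansion of the colored Jones polynomial of the
figure-eight knot at `exp((u+2π√-1)/N)` for real `0 < u < log((3+√5)/2)`. -/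
theorem stmt0 (u : ℝ) (hu0 : 0 < u) (hu1 : u < Real.log ((3 + Real.sqrt 5)/2))
    (ξ : ℂ) (hξ : ξ = (u:ℂ) + 2*(Real.pi:ℂ)*Complex.I)
    (c : ℂ) (hc : c^2 = -ξ * betaRoot u) (hcre : 0 < c.re) (hcim : c.im < 0) :
    Filter.Tendsto
      (fun N : ℕ =>
        JE N (Complex.exp (ξ/(N:ℂ))) * (2 * (Real.sinh (u/2) : ℂ)) * c /
          ((Real.sqrt (2*Real.pi*(N:ℝ)) : ℂ) * Complex.exp (((N:ℂ)/ξ) * Su u)))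
      Filter.atTop (nhds 1) := by
  obtain ⟨h1, h3⟩ := exp_add_exp_neg_lt_three hu0 hu1
  subst hξ
  exact tendsto_JE hu0 h1 h3 hc hcre hcim
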